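/- arXiv:2005.00010 — 4 statements merged into one kernel-verified Lean document; each statement's English description precedes it below -/
import Mathlib

section
/- Let n, d ∈ ℕ, 0 < ε ≤ 1, and 0 < δ < 1/(96n). Then for every (ε,δ)-differentially private mechanism M from ({−1,+1}^d)^n to probability measures on [−1,1]^d, there exists μ ∈ [−1,1]^d such that, with P_μ the product distribution on {−1,+1}^d whose j-th coordinate has mean μ^j, the expectation over X₁,...,Xₙ drawn i.i.d. from P_μ and over the randomness of M of ‖M(X) − μ‖₂² is at least min{ d/6, d²/(2304·ε²·n²) }. -/
open MeasureTheory ProbabilityTheory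
open scoped NNReal ENNReal

/-- Two datasets of size `n` are adjacent if they differ in at most one coordinate. -/
def Adjacent {𝒳 : Type*} {n : ℕ} (X X' : Fin n → 𝒳) : Prop :=
  ∃ i₀ : Fin n, ∀ i : Fin n, i ≠ i₀ → X i = X' i

/-- `(ε,δ)`-differential privacy. -/
def DPriv {𝒳 R : Type*} [MeasurableSpace R] {n : ℕ}
    (M : (Fin n → 𝒳) → Measure R) (ε δ : ℝ) : Prop :=
  ∀ X X' : Fin n → 𝒳, Adjacent X X' →
    ∀ S : Set R, MeasurableSet S →
      M X S ≤ ENNReal.ofReal (Real.exp ε) * M X' S + ENNReal.ofReal δ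

/-- The real value of a random sign (`true ↦ +1`, `false ↦ −1`). -/
def signB (b : Bool) : ℝ := if b then 1 else -1

/-- The distribution on `{−1,+1}` (encoded as `Bool`) with mean `p`:
`+1` with probability `(1+p)/2` and `−1` with probability `(1−p)/2`. -/
noncomputable def bernSign (p : ℝ) : Measure Bool :=
  (((1 + p) / 2).toNNReal : ℝ≥0) • Measure.dirac true
    + (((1 - p) / 2).toNNReal : ℝ≥0) • Measure.dirac false

instance (p : ℝ) : IsFiniteMeasure (bernSign p) := by
  unfold bernSign; infer_instance

/-- The product distribution `P_μ` on `{−1,+1}^d` with mean vector `μ`. -/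
noncomputable def Pprod {d : ℕ} (μ : Fin d → ℝ) : Measure (Fin d → Bool) :=
  Measure.pi fun j => bernSign (μ j)

instance {d : ℕ} (μ : Fin d → ℝ) : IsFiniteMeasure (Pprod μ) := by
  unfold Pprod; infer_instance


noncomputable def wB (p : ℝ) (b : Bool) : ℝ := (1 + p * signB b) / 2

noncomputable def Wx {d : ℕ} (μ : Fin d → ℝ) (x : Fin d → Bool) : ℝ := ∏ j, wB (μ j) (x j)

noncomputable def WX {n d : ℕ} (μ : Fin d → ℝ) (X : Fin n → Fin d → Bool) : ℝ := ∏ i, Wx μ (X i)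

lemma signB_sq (b : Bool) : signB b ^ 2 = 1 := by cases b <;> simp [signB]

lemma abs_signB (b : Bool) : |signB b| = 1 := by cases b <;> simp [signB]

lemma wB_nonneg {p : ℝ} (hp : p ∈ Set.Icc (-1 : ℝ) 1) (b : Bool) : 0 ≤ wB p b := by
  obtain ⟨h1, h2⟩ := hp
  cases b <;> simp [wB, signB] <;> linarith

lemma Wx_nonneg {d : ℕ} {μ : Fin d → ℝ} (hμ : ∀ j, μ j ∈ Set.Icc (-1 : ℝ) 1)
    (x : Fin d → Bool) : 0 ≤ Wx μ x := Finset.prod_nonneg fun j _ => wB_nonneg (hμ j) _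

lemma WX_nonneg {n d : ℕ} {μ : Fin d → ℝ} (hμ : ∀ j, μ j ∈ Set.Icc (-1 : ℝ) 1)
    (X : Fin n → Fin d → Bool) : 0 ≤ WX μ X := Finset.prod_nonneg fun _ _ => Wx_nonneg hμ _

lemma sum_prod_fn {ι κ : Type*} [Fintype ι] [DecidableEq ι] [Fintype κ] (f : ι → κ → ℝ) :
    ∑ x : ι → κ, ∏ i, f i (x i) = ∏ i, ∑ b, f i b := by
  rw [Finset.prod_univ_sum, Fintype.piFinset_univ]

lemma wB_sum (p : ℝ) : ∑ b, wB p b = 1 := by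
  simp [wB, signB]; ring

lemma Wx_sum {d : ℕ} (μ : Fin d → ℝ) : ∑ x, Wx μ x = 1 := by
  unfold Wx
  rw [sum_prod_fn (fun j b => wB (μ j) b)]
  simp only [wB_sum, Finset.prod_const_one]

lemma WX_sum {n d : ℕ} (μ : Fin d → ℝ) : ∑ X : Fin n → Fin d → Bool, WX μ X = 1 := by
  unfold WX
  rw [sum_prod_fn (fun _ x => Wx μ x)]
  simp only [Wx_sum, Finset.prod_const_one]

lemma bern_real {p : ℝ} (hp : p ∈ Set.Icc (-1 : ℝ) 1) (b : Bool) :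
    (bernSign p {b}).toReal = wB p b := by
  obtain ⟨h1, h2⟩ := hp
  cases b
  · simp [bernSign, wB, signB]
    rw [max_eq_left (by linarith)]; ring
  · simp [bernSign, wB, signB]; linarith

lemma int_pi {n d : ℕ} {μ : Fin d → ℝ} (hμ : ∀ j, μ j ∈ Set.Icc (-1 : ℝ) 1)
    (F : (Fin n → Fin d → Bool) → ℝ) :
    ∫ X, F X ∂(Measure.pi fun _ : Fin n => Pprod μ) = ∑ X, WX μ X * F X := by
  rw [integral_fintype Integrable.of_finite]
  refine Finset.sum_congr rfl fun X _ => ?_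
  rw [smul_eq_mul]
  congr 1
  rw [Measure.real, Measure.pi_singleton, ENNReal.toReal_prod]
  refine Finset.prod_congr rfl fun i _ => ?_
  rw [Pprod, Measure.pi_singleton, ENNReal.toReal_prod]
  exact Finset.prod_congr rfl fun j _ => bern_real (hμ j) _

lemma Wx_mean {d : ℕ} (μ : Fin d → ℝ) (j : Fin d) :
    ∑ x, Wx μ x * (signB (x j) - μ j) = 0 := by
  have : ∀ x : Fin d → Bool, Wx μ x * (signB (x j) - μ j) =
      ∏ l, (wB (μ l) (x l) * if l = j then (signB (x l) - μ l) else 1) := by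
    intro x
    rw [Finset.prod_mul_distrib]
    simp [Wx]
  simp only [this]
  rw [sum_prod_fn (fun l b => wB (μ l) b * if l = j then (signB b - μ l) else 1)]
  refine Finset.prod_eq_zero (Finset.mem_univ j) ?_
  simp [wB, signB]; ring

lemma Wx_cov {d : ℕ} (μ : Fin d → ℝ) (j k : Fin d) :
    ∑ x, Wx μ x * ((signB (x j) - μ j) * (signB (x k) - μ k)) =
      if j = k then 1 - μ j ^ 2 else 0 := by
  have : ∀ x : Fin d → Bool, Wx μ x * ((signB (x j) - μ j) * (signB (x k) - μ k)) =
      ∏ l, (wB (μ l) (x l) * ((if l = j then (signB (x l) - μ l) else 1) *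
        (if l = k then (signB (x l) - μ l) else 1))) := by
    intro x
    rw [Finset.prod_mul_distrib, Finset.prod_mul_distrib]
    simp [Wx]
  simp only [this]
  rw [sum_prod_fn (fun l b => wB (μ l) b * ((if l = j then (signB b - μ l) else 1) *
        (if l = k then (signB b - μ l) else 1)))]
  split_ifs with h
  · subst h
    rw [Finset.prod_eq_single j]
    · simp [wB, signB]; ring
    · intro l _ hl
      simp only [hl, if_false, mul_one, wB_sum]
    · simp
  · refine Finset.prod_eq_zero (Finset.mem_univ j) ?_
    simp [wB, signB, h]; ring

noncomputable def phi {d : ℕ} (μ : Fin d → ℝ) (a : Fin d → ℝ) (x : Fin d → Bool) : ℝ :=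
  ∑ j, (a j - μ j) * (signB (x j) - μ j)

lemma phi_mean {d : ℕ} (μ a : Fin d → ℝ) : ∑ x, Wx μ x * phi μ a x = 0 := by
  simp only [phi, Finset.mul_sum]
  rw [Finset.sum_comm]
  refine Finset.sum_eq_zero fun j _ => ?_
  have := Wx_mean μ j
  calc _ = (a j - μ j) * ∑ x, Wx μ x * (signB (x j) - μ j) := by
        rw [Finset.mul_sum]; exact Finset.sum_congr rfl fun _ _ => by ring
    _ = 0 := by rw [this, mul_zero]

lemma phi_sq {d : ℕ} (μ a : Fin d → ℝ) :
    ∑ x, Wx μ x * phi μ a x ^ 2 ≤ ∑ j, (a j - μ j) ^ 2 := by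
  have : ∑ x, Wx μ x * phi μ a x ^ 2 =
      ∑ j, ∑ k, (a j - μ j) * (a k - μ k) *
        ∑ x, Wx μ x * ((signB (x j) - μ j) * (signB (x k) - μ k)) := by
    have e : ∀ x, Wx μ x * phi μ a x ^ 2 = ∑ j, ∑ k, (a j - μ j) * (a k - μ k) *
        (Wx μ x * ((signB (x j) - μ j) * (signB (x k) - μ k))) := by
      intro x
      rw [phi, sq, Finset.sum_mul_sum, Finset.mul_sum]
      refine Finset.sum_congr rfl fun j _ => ?_
      rw [Finset.mul_sum]
      exact Finset.sum_congr rfl fun k _ => by ring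
    simp only [e, Finset.mul_sum]
    rw [Finset.sum_comm]
    refine Finset.sum_congr rfl fun j _ => ?_
    rw [Finset.sum_comm]
  rw [this]
  simp only [Wx_cov]
  refine Finset.sum_le_sum fun j _ => ?_
  simp
  nlinarith [sq_nonneg ((a j - μ j) * μ j)]

lemma phi_abs {d : ℕ} {μ a : Fin d → ℝ} (hμ : ∀ j, μ j ∈ Set.Icc (-1 : ℝ) 1)
    (ha : ∀ j, a j ∈ Set.Icc (-1 : ℝ) 1) (x : Fin d → Bool) : |phi μ a x| ≤ 4 * d := by
  calc |phi μ a x| ≤ ∑ j, |(a j - μ j) * (signB (x j) - μ j)| := Finset.abs_sum_le_sum_abs _ _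
    _ ≤ ∑ j : Fin d, (4 : ℝ) := by
        refine Finset.sum_le_sum fun j _ => ?_
        obtain ⟨h1, h2⟩ := hμ j
        obtain ⟨h3, h4⟩ := ha j
        have e1 : |a j - μ j| ≤ 2 := abs_le.2 ⟨by linarith, by linarith⟩
        have e2 : |signB (x j) - μ j| ≤ 2 := by
          have := abs_le.1 (abs_signB (x j)).le
          exact abs_le.2 ⟨by linarith, by linarith⟩
        rw [abs_mul]
        calc _ ≤ (2 : ℝ) * 2 := mul_le_mul e1 e2 (abs_nonneg _) (by norm_num)
          _ = 4 := by norm_num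
    _ = 4 * d := by simp [mul_comm]

lemma swap_sum {n d : ℕ} (μ : Fin d → ℝ) (i : Fin n)
    (K : (Fin n → Fin d → Bool) → (Fin d → Bool) → ℝ) :
    ∑ X, ∑ x, WX μ X * Wx μ x * K (Function.update X i x) (X i) =
      ∑ X, ∑ x, WX μ X * Wx μ x * K X x := by
  rw [← Fintype.sum_prod_type', ← Fintype.sum_prod_type']
  let e : ((Fin n → Fin d → Bool) × (Fin d → Bool)) → ((Fin n → Fin d → Bool) × (Fin d → Bool)) :=
    fun p => (Function.update p.1 i p.2, p.1 i)
  have he : Function.Involutive e := by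
    intro p
    simp [e]
  refine Fintype.sum_equiv he.toPerm _ _ fun p => ?_
  have : WX μ p.1 * Wx μ p.2 = WX μ (e p).1 * Wx μ (e p).2 := by
    simp only [WX, e]
    rw [← Finset.mul_prod_erase _ _ (Finset.mem_univ i),
      ← Finset.mul_prod_erase _ (fun k => Wx μ (Function.update p.1 i p.2 k)) (Finset.mem_univ i)]
    have : ∏ k ∈ Finset.univ.erase i, Wx μ (Function.update p.1 i p.2 k) =
        ∏ k ∈ Finset.univ.erase i, Wx μ (p.1 k) := by
      refine Finset.prod_congr rfl fun k hk => ?_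
      rw [Function.update_of_ne (Finset.ne_of_mem_erase hk)]
    rw [this]
    simp
    ring
  simp only [Function.Involutive.coe_toPerm]
  rw [this]

lemma dp_pos {Ω : Type*} [MeasurableSpace Ω] (P Q : Measure Ω) [IsProbabilityMeasure P]
    [IsProbabilityMeasure Q] {ε δ : ℝ} (hδ : 0 ≤ δ)
    (h : ∀ S, MeasurableSet S → P S ≤ ENNReal.ofReal (Real.exp ε) * Q S + ENNReal.ofReal δ)
    (g : Ω → ℝ) (hg : Measurable g) (T : ℝ) (hg0 : ∀ y, 0 ≤ g y) (hgT : ∀ y, g y ≤ T) 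
    (hT : 0 ≤ T) :
    ∫ y, g y ∂P ≤ Real.exp ε * ∫ y, g y ∂Q + δ * T := by
  have hint : ∀ (P : Measure Ω) [IsProbabilityMeasure P], Integrable g P := fun P _ =>
    Integrable.of_bound hg.aestronglyMeasurable T (by
      filter_upwards with y
      rw [Real.norm_eq_abs, abs_of_nonneg (hg0 y)]; exact hgT y)
  rw [(hint P).integral_eq_integral_Ioc_meas_le (Filter.Eventually.of_forall hg0)
    (Filter.Eventually.of_forall hgT),
    (hint Q).integral_eq_integral_Ioc_meas_le (Filter.Eventually.of_forall hg0)
    (Filter.Eventually.of_forall hgT)]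
  have hm : ∀ (P : Measure Ω) [IsProbabilityMeasure P],
      IntegrableOn (fun t => P.real {a | t ≤ g a}) (Set.Ioc 0 T) := fun P _ => by
    have : Antitone (fun t => P.real {a | t ≤ g a}) := fun s t hst =>
      measureReal_mono (fun a (ha : t ≤ g a) => hst.trans ha)
    refine Integrable.of_bound this.measurable.aestronglyMeasurable 1 ?_
    filter_upwards with t
    rw [Real.norm_eq_abs, abs_of_nonneg measureReal_nonneg]
    exact measureReal_le_one
  have hle : ∀ t, P.real {a | t ≤ g a} ≤ Real.exp ε * Q.real {a | t ≤ g a} + δ := fun t => by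
    have := h {a | t ≤ g a} (measurableSet_le measurable_const hg)
    have h2 := ENNReal.toReal_mono (by finiteness) this
    rw [ENNReal.toReal_add (by finiteness) (by finiteness), ENNReal.toReal_mul,
      ENNReal.toReal_ofReal (Real.exp_pos ε).le, ENNReal.toReal_ofReal hδ] at h2
    exact h2
  calc _ ≤ ∫ t in Set.Ioc 0 T, (Real.exp ε * Q.real {a | t ≤ g a} + δ) :=
        integral_mono (hm P) (((hm Q).const_mul _).add (integrable_const _)) hle
    _ = _ := by
        rw [integral_add ((hm Q).const_mul _) (integrable_const _), integral_const_mul]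
        simp [hT, mul_comm]

lemma dp_fun {Ω : Type*} [MeasurableSpace Ω] (P Q : Measure Ω) [IsProbabilityMeasure P]
    [IsProbabilityMeasure Q] {ε δ : ℝ} (hδ : 0 ≤ δ) (hε : 0 ≤ ε)
    (h : ∀ S, MeasurableSet S → P S ≤ ENNReal.ofReal (Real.exp ε) * Q S + ENNReal.ofReal δ)
    (h' : ∀ S, MeasurableSet S → Q S ≤ ENNReal.ofReal (Real.exp ε) * P S + ENNReal.ofReal δ)
    (g : Ω → ℝ) (hg : Measurable g) (T : ℝ) (hgT : ∀ y, |g y| ≤ T) (hT : 0 ≤ T) :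
    ∫ y, g y ∂P ≤ ∫ y, g y ∂Q + (Real.exp ε - 1) * ∫ y, |g y| ∂Q + 2 * δ * T := by
  have m1 : Measurable (fun y => max (g y) 0) := hg.max measurable_const
  have m2 : Measurable (fun y => max (-g y) 0) := hg.neg.max measurable_const
  have b1 : ∀ y, max (g y) 0 ≤ T := fun y => max_le ((le_abs_self _).trans (hgT y)) hT
  have b2 : ∀ y, max (-g y) 0 ≤ T := fun y => max_le ((neg_le_abs _).trans (hgT y)) hT
  have p1 := dp_pos P Q hδ h _ m1 T (fun y => le_max_right _ _) b1 hT
  have p2 := dp_pos Q P hδ h' _ m2 T (fun y => le_max_right _ _) b2 hT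
  have i1 : ∀ (P : Measure Ω) [IsProbabilityMeasure P], Integrable (fun y => max (g y) 0) P :=
    fun P _ => Integrable.of_bound m1.aestronglyMeasurable T (by
      filter_upwards with y
      rw [Real.norm_eq_abs, abs_of_nonneg (le_max_right _ _)]; exact b1 y)
  have i2 : ∀ (P : Measure Ω) [IsProbabilityMeasure P], Integrable (fun y => max (-g y) 0) P :=
    fun P _ => Integrable.of_bound m2.aestronglyMeasurable T (by
      filter_upwards with y
      rw [Real.norm_eq_abs, abs_of_nonneg (le_max_right _ _)]; exact b2 y)
  have e1 : ∀ (P : Measure Ω) [IsProbabilityMeasure P],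
      ∫ y, g y ∂P = ∫ y, max (g y) 0 ∂P - ∫ y, max (-g y) 0 ∂P := fun P _ => by
    rw [← integral_sub (i1 P) (i2 P)]
    congr 1; ext y
    rcases le_total 0 (g y) with h | h
    · rw [max_eq_left h, max_eq_right (by linarith)]; ring
    · rw [max_eq_right h, max_eq_left (by linarith)]; ring
  have e2 : ∫ y, |g y| ∂Q = ∫ y, max (g y) 0 ∂Q + ∫ y, max (-g y) 0 ∂Q := by
    rw [← integral_add (i1 Q) (i2 Q)]
    congr 1; ext y
    rcases le_total 0 (g y) with h | h
    · rw [max_eq_left h, max_eq_right (by linarith), abs_of_nonneg h]; ring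
    · rw [max_eq_right h, max_eq_left (by linarith), abs_of_nonpos h]; ring
  rw [e1 P, e1 Q, e2]
  have n2 : 0 ≤ ∫ y, max (-g y) 0 ∂Q := integral_nonneg fun y => le_max_right _ _
  have n3 : 0 ≤ ∫ y, max (-g y) 0 ∂P := integral_nonneg fun y => le_max_right _ _
  generalize ∫ y, max (g y) 0 ∂P = A at *
  generalize ∫ y, max (g y) 0 ∂Q = B at *
  generalize ∫ y, max (-g y) 0 ∂P = C at *
  generalize ∫ y, max (-g y) 0 ∂Q = D at *
  have hE : 1 ≤ Real.exp ε := Real.one_le_exp hε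
  generalize Real.exp ε = E at *
  have hdT : 0 ≤ δ * T := mul_nonneg hδ hT
  -- D ≤ E C + δT ; need C ≥ D - (E-1) D - δT
  have key : D - (E - 1) * D - δ * T ≤ C := by
    by_contra hc
    push Not at hc
    have : E * C < E * (D - (E - 1) * D - δ * T) := mul_lt_mul_of_pos_left hc (by linarith)
    nlinarith [mul_nonneg (sq_nonneg (E - 1)) n2, mul_nonneg (sub_nonneg.2 hE) hdT]
  linarith

abbrev II : Type := Set.Icc (-1 : ℝ) 1

noncomputable def nuI : Measure II := ENNReal.ofReal (1 / 2) • (Measure.comap Subtype.val volume)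

lemma nuI_int (f : ℝ → ℝ) : ∫ t : II, f t ∂nuI = (1 / 2) * ∫ t in (-1 : ℝ)..1, f t := by
  rw [nuI, integral_smul_measure, integral_subtype_comap measurableSet_Icc,
    intervalIntegral.integral_of_le (by norm_num), integral_Icc_eq_integral_Ioc]
  simp

instance : IsProbabilityMeasure nuI := by
  constructor
  rw [nuI, Measure.smul_apply, comap_subtype_coe_apply measurableSet_Icc]
  rw [Set.image_univ, Subtype.range_coe, Real.volume_Icc, smul_eq_mul,
    ← ENNReal.ofReal_mul (by norm_num)]
  norm_num

lemma update_mp {d : ℕ} (j : Fin d) :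
    MeasurePreserving (fun p : (Fin d → II) × II => Function.update p.1 j p.2)
      ((Measure.pi fun _ : Fin d => nuI).prod nuI) (Measure.pi fun _ : Fin d => nuI) := by
  have hm : Measurable (fun p : (Fin d → II) × II => Function.update p.1 j p.2) := by
    refine measurable_pi_iff.2 fun k => ?_
    by_cases hk : k = j
    · subst hk; simpa using measurable_snd
    · simp only [Function.update_of_ne hk]
      fun_prop
  refine ⟨hm, ?_⟩
  symm
  refine Measure.pi_eq fun s hs => ?_
  rw [Measure.map_apply hm (MeasurableSet.univ_pi hs)]
  have : (fun p : (Fin d → II) × II => Function.update p.1 j p.2) ⁻¹' (Set.univ.pi s) =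
      (Set.univ.pi (Function.update s j Set.univ)) ×ˢ s j := by
    ext ⟨a, t⟩
    simp only [Set.mem_preimage, Set.mem_pi, Set.mem_univ, true_imp_iff, Set.mem_prod]
    constructor
    · intro h
      refine ⟨fun k => ?_, by simpa using h j⟩
      by_cases hk : k = j
      · subst hk; simp
      · simpa [hk] using h k
    · rintro ⟨h1, h2⟩ k
      by_cases hk : k = j
      · subst hk; simpa using h2
      · simpa [hk] using h1 k
  rw [this, Measure.prod_prod, Measure.pi_pi,
    ← Finset.prod_erase_mul _ _ (Finset.mem_univ j),
    ← Finset.prod_erase_mul _ (fun i => nuI (s i)) (Finset.mem_univ j)]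
  simp only [Function.update_self, measure_univ, mul_one]
  congr 1
  refine Finset.prod_congr rfl fun k hk => ?_
  rw [Function.update_of_ne (Finset.ne_of_mem_erase hk)]

lemma exists_avg {d : ℕ} (G : Fin d → (Fin d → II) → ℝ) (hc : ∀ j, Continuous (G j)) (c : ℝ)
    (h : ∀ j μ, c ≤ ∫ t, G j (Function.update μ j t) ∂nuI) :
    ∃ μ, d * c ≤ ∑ j, G j μ := by
  have hi : ∀ j, Integrable (G j) (Measure.pi fun _ : Fin d => nuI) := fun j =>
    (hc j).integrable_of_hasCompactSupport (HasCompactSupport.of_compactSpace _)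
  obtain ⟨μ, hμ⟩ := exists_integral_le (integrable_finsetSum Finset.univ fun j _ => hi j)
  refine ⟨μ, le_trans ?_ hμ⟩
  rw [integral_finsetSum _ fun j _ => hi j]
  have : ∀ j ∈ Finset.univ, c ≤ ∫ a, G j a ∂(Measure.pi fun _ : Fin d => nuI) := fun j _ => by
    have mp := update_mp j
    rw [← mp.map_eq, integral_map mp.measurable.aemeasurable (hc j).aestronglyMeasurable]
    have hi2 : Integrable (fun p : (Fin d → II) × II => G j (Function.update p.1 j p.2))
        ((Measure.pi fun _ : Fin d => nuI).prod nuI) := mp.integrable_comp_of_integrable (hi j)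
    rw [integral_prod _ hi2]
    calc c = ∫ _, c ∂(Measure.pi fun _ : Fin d => nuI) := by simp
      _ ≤ _ := integral_mono (integrable_const _) hi2.integral_prod_left fun μ => h j μ
  calc (d : ℝ) * c = ∑ j : Fin d, c := by simp
    _ ≤ _ := Finset.sum_le_sum this

lemma hasDeriv_W {ι : Type*} (c : ι → ℝ) (b : ι → Bool) (t : ℝ) (s : Finset ι) :
    ∃ D, HasDerivAt (fun t => ∏ i ∈ s, c i * wB t (b i)) D t ∧
      (1 - t ^ 2) * D = (∏ i ∈ s, c i * wB t (b i)) * ∑ i ∈ s, (signB (b i) - t) := by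
  classical
  induction s using Finset.induction_on with
  | empty => exact ⟨0, by simpa using hasDerivAt_const t (1 : ℝ), by simp⟩
  | insert a s ha ih =>
    obtain ⟨D, hD, hE⟩ := ih
    have h1 : HasDerivAt (fun t => c a * wB t (b a)) (c a * (signB (b a) / 2)) t := by
      unfold wB
      have := ((((hasDerivAt_id t).mul_const (signB (b a))).const_add 1).div_const 2).const_mul (c a)
      simpa using this
    refine ⟨_, (h1.mul hD).congr_of_eventuallyEq (Filter.Eventually.of_forall fun t => ?_), ?_⟩
    · simp [Finset.prod_insert ha]
    · rw [Finset.prod_insert ha, Finset.sum_insert ha]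
      have hs := signB_sq (b a)
      have e : (1 - t ^ 2) * (signB (b a) / 2) = wB t (b a) * (signB (b a) - t) := by
        unfold wB
        linear_combination (-t / 2) * hs
      linear_combination (c a * wB t (b a)) * hE +
        (c a * ∏ i ∈ s, c i * wB t (b i)) * e

lemma WX_update {n d : ℕ} (μ : Fin d → ℝ) (j : Fin d) (X : Fin n → Fin d → Bool) (t : ℝ) :
    WX (Function.update μ j t) X =
      ∏ i, (∏ k ∈ Finset.univ.erase j, wB (μ k) (X i k)) * wB t (X i j) := by
  unfold WX Wx
  refine Finset.prod_congr rfl fun i _ => ?_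
  rw [← Finset.prod_erase_mul _ _ (Finset.mem_univ j)]
  congr 1
  · refine Finset.prod_congr rfl fun k hk => ?_
    rw [Function.update_of_ne (Finset.ne_of_mem_erase hk)]
  · simp

noncomputable def GG {n d : ℕ} (f q : (Fin n → Fin d → Bool) → Fin d → ℝ) (j : Fin d)
    (μ : Fin d → ℝ) : ℝ :=
  ∑ X, WX μ X * ((f X j - μ j) * ∑ i, (signB (X i j) - μ j) +
    (q X j - 2 * μ j * f X j + μ j ^ 2))

lemma WX_cont {n d : ℕ} (X : Fin n → Fin d → Bool) : Continuous (fun μ : Fin d → ℝ => WX μ X) := by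
  unfold WX Wx wB
  fun_prop

lemma GG_cont {n d : ℕ} (f q : (Fin n → Fin d → Bool) → Fin d → ℝ) (j : Fin d) :
    Continuous (GG f q j) := by
  unfold GG
  have := @WX_cont n d
  fun_prop

lemma GG_int {n d : ℕ} (f q : (Fin n → Fin d → Bool) → Fin d → ℝ) (hq : ∀ X j, 0 ≤ q X j)
    (j : Fin d) (μ : Fin d → ℝ) (hμ : ∀ j, μ j ∈ Set.Icc (-1 : ℝ) 1) :
    2 / 3 ≤ ∫ t in (-1 : ℝ)..1, GG f q j (Function.update μ j t) := by
  have hup : Continuous (fun t : ℝ => Function.update μ j t) := by fun_prop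
  let S : ℝ → ℝ := fun t => ∑ X, WX (Function.update μ j t) X * (1 - 2 * t ^ 2 + q X j)
  let D : ℝ → ℝ := fun t => GG f q j (Function.update μ j t) - S t
  let H : ℝ → ℝ := fun t => ∑ X, (f X j - t) * (1 - t ^ 2) * WX (Function.update μ j t) X
  have hcG : Continuous (fun t : ℝ => GG f q j (Function.update μ j t)) := (GG_cont f q j).comp hup
  have hcS : Continuous S := by
    have : ∀ X : Fin n → Fin d → Bool, Continuous (fun t : ℝ => WX (Function.update μ j t) X) :=
      fun X => (WX_cont X).comp hup
    fun_prop
  have hcD : Continuous D := hcG.sub hcS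
  have hH : ∀ t, HasDerivAt H (D t) t := by
    intro t
    have : D t = ∑ X, WX (Function.update μ j t) X * ((f X j - t) * ∑ i, (signB (X i j) - t) +
        (q X j - 2 * t * f X j + t ^ 2) - (1 - 2 * t ^ 2 + q X j)) := by
      simp only [D, S, GG, ← Finset.sum_sub_distrib, Function.update_self]
      exact Finset.sum_congr rfl fun X _ => by ring
    rw [this]
    refine HasDerivAt.fun_sum fun X _ => ?_
    simp only [WX_update]
    obtain ⟨E, hE, hE2⟩ := hasDeriv_W (fun i => ∏ k ∈ Finset.univ.erase j, wB (μ k) (X i k))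
      (fun i => X i j) t Finset.univ
    have h1 : HasDerivAt (fun t : ℝ => (f X j - t) * (1 - t ^ 2))
        ((-1) * (1 - t ^ 2) + (f X j - t) * (-(2 * t))) t := by
      have a1 := (hasDerivAt_id t).const_sub (f X j)
      have a2 := ((hasDerivAt_id t).pow 2).const_sub 1
      refine (a1.mul a2).congr_deriv ?_
      simp
    refine (h1.mul hE).congr_deriv ?_
    linear_combination (f X j - t) * hE2
  have hI : ∫ t in (-1 : ℝ)..1, D t = 0 := by
    rw [intervalIntegral.integral_eq_sub_of_hasDerivAt (fun t _ => hH t)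
      (hcD.intervalIntegrable _ _)]
    simp [H]
  have hle : ∀ t ∈ Set.Icc (-1 : ℝ) 1, D t + (1 - 2 * t ^ 2) ≤ GG f q j (Function.update μ j t) := by
    intro t ht
    have hμ' : ∀ k, Function.update μ j t k ∈ Set.Icc (-1 : ℝ) 1 := by
      intro k
      by_cases hk : k = j
      · subst hk; simpa using ht
      · rw [Function.update_of_ne hk]; exact hμ k
    have : 1 - 2 * t ^ 2 ≤ S t := by
      calc 1 - 2 * t ^ 2 = ∑ X : Fin n → Fin d → Bool,
            WX (Function.update μ j t) X * (1 - 2 * t ^ 2) := by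
            rw [← Finset.sum_mul, WX_sum, one_mul]
        _ ≤ S t := Finset.sum_le_sum fun X _ =>
            mul_le_mul_of_nonneg_left (by linarith [hq X j]) (WX_nonneg hμ' X)
    simp only [D]
    linarith
  have hp : Continuous (fun t : ℝ => 1 - 2 * t ^ 2) := by fun_prop
  calc (2 / 3 : ℝ) = ∫ t in (-1 : ℝ)..1, (D t + (1 - 2 * t ^ 2)) := by
        rw [intervalIntegral.integral_add (hcD.intervalIntegrable _ _)
          (hp.intervalIntegrable _ _), hI, intervalIntegral.integral_sub
          (Continuous.intervalIntegrable (by fun_prop) _ _) (Continuous.intervalIntegrable (by fun_prop) _ _),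
          intervalIntegral.integral_const_mul, integral_pow]
        norm_num
    _ ≤ _ := intervalIntegral.integral_mono_on (by norm_num)
        ((hcD.add hp).intervalIntegrable _ _) (hcG.intervalIntegrable _ _) hle

lemma fingerprint {n d : ℕ} (f q : (Fin n → Fin d → Bool) → Fin d → ℝ)
    (hq : ∀ X j, 0 ≤ q X j) :
    ∃ μ : Fin d → ℝ, (∀ j, μ j ∈ Set.Icc (-1 : ℝ) 1) ∧ (d : ℝ) * (1 / 3) ≤ ∑ j, GG f q j μ := by
  obtain ⟨μ, hμ⟩ := exists_avg (fun j (μ : Fin d → II) => GG f q j (fun k => (μ k : ℝ)))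
    (fun j => (GG_cont f q j).comp (by fun_prop)) (1 / 3) (by
      intro j μ
      have e : ∀ t : II, (fun k => ((Function.update μ j t k : II) : ℝ)) =
          Function.update (fun k => (μ k : ℝ)) j (t : ℝ) := by
        intro t
        ext k
        by_cases hk : k = j
        · subst hk; simp
        · simp [hk]
      simp only [e]
      rw [nuI_int (fun t => GG f q j (Function.update (fun k => (μ k : ℝ)) j t))]
      have := GG_int f q hq j (fun k => (μ k : ℝ)) (fun k => (μ k).2)
      linarith)
  exact ⟨fun k => μ k, fun k => (μ k).2, hμ⟩

lemma II_int {d : ℕ} (P : Measure (Fin d → II)) [IsProbabilityMeasure P] (g : (Fin d → II) → ℝ)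
    (hg : Continuous g) : Integrable g P :=
  hg.integrable_of_hasCompactSupport (HasCompactSupport.of_compactSpace _)

lemma phi_cont {d : ℕ} (μ : Fin d → ℝ) (x : Fin d → Bool) :
    Continuous (fun y : Fin d → II => phi μ (fun k => (y k : ℝ)) x) := by
  unfold phi; fun_prop

lemma avg_bound {d : ℕ} {μ : Fin d → ℝ} (hμ : ∀ j, μ j ∈ Set.Icc (-1 : ℝ) 1)
    (P : Measure (Fin d → II)) [IsProbabilityMeasure P] {c : ℝ} (hc : 0 < c) :
    ∑ x, Wx μ x * ∫ y, |phi μ (fun k => (y k : ℝ)) x| ∂P ≤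
      ((∫ y, ∑ j, ((y j : ℝ) - μ j) ^ 2 ∂P) / c + c) / 2 := by
  have hi : ∀ x, Integrable (fun y : Fin d → II => |phi μ (fun k => (y k : ℝ)) x|) P := fun x =>
    II_int P _ (phi_cont μ x).abs
  have hr : Integrable (fun y : Fin d → II => ∑ j, ((y j : ℝ) - μ j) ^ 2) P :=
    II_int P _ (by fun_prop)
  simp only [← integral_const_mul]
  rw [← integral_finsetSum _ fun x _ => (hi x).const_mul _]
  have : ((∫ y, ∑ j, ((y j : ℝ) - μ j) ^ 2 ∂P) / c + c) / 2 =
      ∫ y, ((∑ j, ((y j : ℝ) - μ j) ^ 2) / c + c) / 2 ∂P := by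
    rw [integral_div, integral_add (hr.div_const _) (integrable_const _), integral_div]
    simp
  rw [this]
  refine integral_mono (integrable_finsetSum _ fun x _ => (hi x).const_mul _)
    (((hr.div_const _).add (integrable_const _)).div_const _) fun y => ?_
  have h2 := phi_sq μ (fun k => (y k : ℝ))
  calc ∑ x, Wx μ x * |phi μ (fun k => (y k : ℝ)) x|
      ≤ ∑ x, Wx μ x * ((phi μ (fun k => (y k : ℝ)) x ^ 2 / c + c) / 2) := by
        refine Finset.sum_le_sum fun x _ => mul_le_mul_of_nonneg_left ?_ (Wx_nonneg hμ x)
        rw [← sq_abs (phi μ (fun k => (y k : ℝ)) x)]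
        generalize |phi μ (fun k => (y k : ℝ)) x| = a
        have : (a ^ 2 / c + c) / 2 - a = (a - c) ^ 2 / (2 * c) := by field_simp; ring
        have : 0 ≤ (a - c) ^ 2 / (2 * c) := by positivity
        linarith
    _ = ((∑ x, Wx μ x * phi μ (fun k => (y k : ℝ)) x ^ 2) / c + (∑ x, Wx μ x) * c) / 2 := by
        rw [Finset.sum_div, Finset.sum_mul, ← Finset.sum_add_distrib, Finset.sum_div]
        exact Finset.sum_congr rfl fun x _ => by ring
    _ ≤ _ := by
        rw [Wx_sum, one_mul]
        gcongr

lemma upper {n d : ℕ} {ε δ : ℝ} (hε : 0 ≤ ε) (hδ : 0 ≤ δ)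
    (M : (Fin n → (Fin d → Bool)) → Measure (Fin d → II))
    (hM : ∀ X, IsProbabilityMeasure (M X)) (hDP : DPriv M ε δ)
    {μ : Fin d → ℝ} (hμ : ∀ j, μ j ∈ Set.Icc (-1 : ℝ) 1) {c : ℝ} (hc : 0 < c)
    (hR : ∑ X, WX μ X * ∫ y, ∑ j, ((y j : ℝ) - μ j) ^ 2 ∂(M X) ≤ c ^ 2) (i : Fin n) :
    ∑ X, WX μ X * ∫ y, phi μ (fun k => (y k : ℝ)) (X i) ∂(M X) ≤
      (Real.exp ε - 1) * c + 8 * d * δ := by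
  have hE : 0 ≤ Real.exp ε - 1 := by linarith [Real.one_le_exp hε]
  let K : (Fin n → Fin d → Bool) → (Fin d → Bool) → ℝ := fun X x =>
    ∫ y, phi μ (fun k => (y k : ℝ)) x ∂(M X) +
      (Real.exp ε - 1) * ∫ y, |phi μ (fun k => (y k : ℝ)) x| ∂(M X) + 2 * δ * (4 * d)
  calc ∑ X, WX μ X * ∫ y, phi μ (fun k => (y k : ℝ)) (X i) ∂(M X)
      = ∑ X, ∑ x, WX μ X * Wx μ x * ∫ y, phi μ (fun k => (y k : ℝ)) (X i) ∂(M X) := by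
        refine Finset.sum_congr rfl fun X _ => ?_
        rw [← Finset.sum_mul, ← Finset.mul_sum, Wx_sum, mul_one]
    _ ≤ ∑ X, ∑ x, WX μ X * Wx μ x * K (Function.update X i x) (X i) := by
        refine Finset.sum_le_sum fun X _ => Finset.sum_le_sum fun x _ =>
          mul_le_mul_of_nonneg_left ?_ (mul_nonneg (WX_nonneg hμ X) (Wx_nonneg hμ x))
        refine dp_fun (M X) (M (Function.update X i x)) hδ hε
          (hDP _ _ ⟨i, fun k hk => ?_⟩) (hDP _ _ ⟨i, fun k hk => ?_⟩) _
          (phi_cont μ (X i)).measurable _ (fun y => phi_abs hμ (fun k => (y k).2) _)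
          (by positivity)
        · rw [Function.update_of_ne hk]
        · rw [Function.update_of_ne hk]
    _ = ∑ X, ∑ x, WX μ X * Wx μ x * K X x := swap_sum μ i K
    _ ≤ ∑ X, WX μ X * ((Real.exp ε - 1) *
          (((∫ y, ∑ j, ((y j : ℝ) - μ j) ^ 2 ∂(M X)) / c + c) / 2) + 8 * d * δ) := by
        refine Finset.sum_le_sum fun X _ => ?_
        simp only [mul_assoc (WX μ X)]
        rw [← Finset.mul_sum]
        refine mul_le_mul_of_nonneg_left ?_ (WX_nonneg hμ X)
        have h0 : ∑ x, Wx μ x * ∫ y, phi μ (fun k => (y k : ℝ)) x ∂(M X) = 0 := by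
          simp only [← integral_const_mul]
          rw [← integral_finsetSum _ fun x _ => (II_int (M X) _ (phi_cont μ x)).const_mul _]
          simp only [phi_mean, integral_zero]
        have h1 := avg_bound hμ (M X) hc
        calc ∑ x, Wx μ x * K X x = ∑ x, Wx μ x * ∫ y, phi μ (fun k => (y k : ℝ)) x ∂(M X) +
            (Real.exp ε - 1) * ∑ x, Wx μ x * ∫ y, |phi μ (fun k => (y k : ℝ)) x| ∂(M X) +
            (∑ x, Wx μ x) * (8 * d * δ) := by
              rw [Finset.mul_sum, Finset.sum_mul, ← Finset.sum_add_distrib,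
                ← Finset.sum_add_distrib]
              exact Finset.sum_congr rfl fun x _ => by simp only [K]; ring
          _ ≤ _ := by
              rw [h0, Wx_sum, one_mul, zero_add]
              gcongr
    _ = (Real.exp ε - 1) * (((∑ X, WX μ X * ∫ y, ∑ j, ((y j : ℝ) - μ j) ^ 2 ∂(M X)) / c
          + (∑ X : Fin n → Fin d → Bool, WX μ X) * c) / 2) +
          (∑ X : Fin n → Fin d → Bool, WX μ X) * (8 * d * δ) := by
        rw [Finset.sum_div, Finset.sum_mul, Finset.sum_mul, ← Finset.sum_add_distrib,
          Finset.sum_div, Finset.mul_sum, ← Finset.sum_add_distrib]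
        exact Finset.sum_congr rfl fun x _ => by ring
    _ ≤ _ := by
        rw [WX_sum, one_mul, one_mul]
        have : (∑ X, WX μ X * ∫ y, ∑ j, ((y j : ℝ) - μ j) ^ 2 ∂(M X)) / c ≤ c := by
          rw [div_le_iff₀ hc]; linarith [sq c]
        gcongr
        linarith

/-- minimax lower bound for private mean estimation.  For every
`(ε,δ)`-differentially private mechanism `M` from `({−1,+1}^d)^n` to probability
measures on `[−1,1]^d` (with `0 < ε ≤ 1` and `δ < 1/(96 n)`), there is a mean
vector `μ ∈ [−1,1]^d` such that on i.i.d. data from `P_μ`, the expected squared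
ℓ₂-error of `M` is at least `min (d/6) (d²/(2304 ε² n²))`. -/
theorem private_mean_estimation_lower_bound (n d : ℕ) (hn : 0 < n) (ε δ : ℝ)
    (hε : 0 < ε) (hε1 : ε ≤ 1) (hδ0 : 0 < δ) (hδ : δ < 1 / (96 * n))
    (M : (Fin n → (Fin d → Bool)) → Measure (Fin d → Set.Icc (-1 : ℝ) 1))
    (hM : ∀ X, IsProbabilityMeasure (M X))
    (hDP : DPriv M ε δ) :
    ∃ μ : Fin d → ℝ, (∀ j, μ j ∈ Set.Icc (-1 : ℝ) 1) ∧
      min ((d : ℝ) / 6) ((d : ℝ) ^ 2 / (2304 * ε ^ 2 * n ^ 2)) ≤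
        ∫ X, ∫ y, ∑ j, ((y j : ℝ) - μ j) ^ 2
          ∂(M X) ∂(Measure.pi fun _ : Fin n => Pprod μ) := by
  rcases Nat.eq_zero_or_pos d with hd | hd
  · subst hd
    exact ⟨0, fun j => j.elim0, by simp⟩
  have hd' : (0 : ℝ) < d := by exact_mod_cast hd
  have hn' : (0 : ℝ) < n := by exact_mod_cast hn
  obtain ⟨μ, hμ, hG⟩ := fingerprint (fun X j => ∫ y, (y j : ℝ) ∂(M X))
    (fun X j => ∫ y, (y j : ℝ) ^ 2 ∂(M X)) (fun X j => integral_nonneg fun y => sq_nonneg _)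
  refine ⟨μ, hμ, ?_⟩
  rw [int_pi hμ]
  by_contra hlt
  push Not at hlt
  obtain ⟨hl1, hl2⟩ := lt_min_iff.1 hlt
  set c : ℝ := d / (48 * ε * n) with hcdef
  have hc : 0 < c := by positivity
  have hc2 : (d : ℝ) ^ 2 / (2304 * ε ^ 2 * n ^ 2) = c ^ 2 := by
    rw [hcdef]; field_simp; norm_num
  rw [hc2] at hl2
  have hU := fun i => upper hε.le hδ0.le M hM hDP hμ hc hl2.le i
  have hS : ∑ i, ∑ X, WX μ X * ∫ y, phi μ (fun k => (y k : ℝ)) (X i) ∂(M X) ≤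
      n * ((Real.exp ε - 1) * c + 8 * d * δ) := by
    calc _ ≤ ∑ i : Fin n, ((Real.exp ε - 1) * c + 8 * d * δ) := Finset.sum_le_sum fun i _ => hU i
      _ = _ := by rw [Finset.sum_const, Finset.card_univ, Fintype.card_fin, nsmul_eq_mul]
  have hI1 : ∀ X j, Integrable (fun y : Fin d → II => (y j : ℝ)) (M X) := fun X j =>
    II_int (M X) _ (by fun_prop)
  have hI2 : ∀ X j, Integrable (fun y : Fin d → II => (y j : ℝ) ^ 2) (M X) := fun X j =>
    II_int (M X) _ (by fun_prop)
  have hphi : ∀ X x, ∫ y, phi μ (fun k => (y k : ℝ)) x ∂(M X) =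
      ∑ j, (∫ y, (y j : ℝ) ∂(M X) - μ j) * (signB (x j) - μ j) := by
    intro X x
    unfold phi
    rw [integral_finsetSum _ fun j _ => II_int (M X) _ (by fun_prop)]
    refine Finset.sum_congr rfl fun j _ => ?_
    rw [integral_mul_const, integral_sub (hI1 X j) (integrable_const _)]
    simp
  have hr : ∀ X, ∫ y, ∑ j, ((y j : ℝ) - μ j) ^ 2 ∂(M X) =
      ∑ j, (∫ y, (y j : ℝ) ^ 2 ∂(M X) - 2 * μ j * ∫ y, (y j : ℝ) ∂(M X) + μ j ^ 2) := by
    intro X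
    rw [integral_finsetSum _ fun j _ => II_int (M X) _ (by fun_prop)]
    refine Finset.sum_congr rfl fun j _ => ?_
    calc ∫ y, ((y j : ℝ) - μ j) ^ 2 ∂(M X)
        = ∫ y, ((y j : ℝ) ^ 2 - 2 * μ j * (y j : ℝ) + μ j ^ 2) ∂(M X) := by
          congr 1; ext y; ring
      _ = _ := by
          rw [integral_add (II_int (M X) _ (by fun_prop)) (integrable_const _),
            integral_sub (hI2 X j) ((hI1 X j).const_mul _), integral_const_mul]
          simp
  have hGG : ∑ j, GG (fun X j => ∫ y, (y j : ℝ) ∂(M X)) (fun X j => ∫ y, (y j : ℝ) ^ 2 ∂(M X)) j μ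
      = ∑ i, ∑ X, WX μ X * ∫ y, phi μ (fun k => (y k : ℝ)) (X i) ∂(M X) +
        ∑ X, WX μ X * ∫ y, ∑ j, ((y j : ℝ) - μ j) ^ 2 ∂(M X) := by
    unfold GG
    rw [Finset.sum_comm, Finset.sum_comm (s := (Finset.univ : Finset (Fin n))),
      ← Finset.sum_add_distrib]
    refine Finset.sum_congr rfl fun X _ => ?_
    rw [← Finset.mul_sum, ← Finset.mul_sum, ← mul_add, Finset.sum_add_distrib, hr]
    simp only [hphi]
    rw [Finset.sum_comm]
    simp only [Finset.mul_sum]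
  rw [hGG] at hG
  have hexp : Real.exp ε - 1 ≤ 2 * ε := by
    have := Real.abs_exp_sub_one_le (x := ε) (by rw [abs_of_pos hε]; exact hε1)
    rw [abs_of_pos hε] at this
    exact (le_abs_self _).trans this
  have h1 : n * ((Real.exp ε - 1) * c) ≤ d / 24 := by
    calc n * ((Real.exp ε - 1) * c) ≤ n * ((2 * ε) * c) := by gcongr
      _ = d / 24 := by rw [hcdef]; field_simp; norm_num
  have h2 : n * (8 * d * δ) ≤ d / 12 := by
    have : n * δ ≤ 1 / 96 := by
      rw [lt_div_iff₀ (by positivity)] at hδ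
      linarith
    calc n * (8 * d * δ) = 8 * d * (n * δ) := by ring
      _ ≤ 8 * d * (1 / 96) := by gcongr
      _ = d / 12 := by ring
  rw [mul_add] at hS
  linarith
end

section
/- Let P and Q be probability measures on a measurable space such that for every measurable set S, P(S) ≤ exp(ε)·Q(S) + δ and Q(S) ≤ exp(ε)·P(S) + δ, where ε, δ ≥ 0. Let f be a measurable real-valued function with |f| ≤ b everywhere. Then the expectation of f under P is at most the expectation of f under Q plus (exp(ε) − 1) times the expectation of |f| under Q plus 2·δ·b. -/
open MeasureTheory

lemma aux_meas_int {Ω : Type*} [MeasurableSpace Ω] (P : Measure Ω) [IsProbabilityMeasure P]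
    (b : ℝ) (g : Ω → ℝ) :
    IntegrableOn (fun t : ℝ => P.real {a | t ≤ g a}) (Set.Ioc 0 b) volume := by
  have hanti : Antitone (fun t : ℝ => P.real {a | t ≤ g a}) := by
    intro s t hst
    exact measureReal_mono (fun a (ha : t ≤ g a) => le_trans hst ha)
  exact ((hanti.antitoneOn _).integrableOn_isCompact isCompact_Icc).mono_set
    Set.Ioc_subset_Icc_self

lemma aux_transfer {Ω : Type*} [MeasurableSpace Ω]
    (P Q : Measure Ω) [IsProbabilityMeasure P] [IsProbabilityMeasure Q]
    (c δ b : ℝ) (hb : 0 ≤ b)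
    (hPQ : ∀ S : Set Ω, MeasurableSet S → (P S).toReal ≤ c * (Q S).toReal + δ)
    (g : Ω → ℝ) (hg : Measurable g) (h0 : ∀ ω, 0 ≤ g ω) (hgb : ∀ ω, g ω ≤ b)
    (hP : Integrable g P) (hQ : Integrable g Q) :
    ∫ ω, g ω ∂P ≤ c * ∫ ω, g ω ∂Q + δ * b := by
  rw [hP.integral_eq_integral_Ioc_meas_le (Filter.Eventually.of_forall h0)
      (Filter.Eventually.of_forall hgb),
    hQ.integral_eq_integral_Ioc_meas_le (Filter.Eventually.of_forall h0)
      (Filter.Eventually.of_forall hgb)]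
  have hc : IntegrableOn (fun _ : ℝ => δ) (Set.Ioc 0 b) volume := by
    apply integrableOn_const <;> simp
  calc _ ≤ ∫ t in Set.Ioc 0 b, (c * Q.real {a | t ≤ g a} + δ) := by
        apply integral_mono (aux_meas_int P b g) (((aux_meas_int Q b g).const_mul c).add hc)
        intro t
        exact hPQ _ (measurableSet_le measurable_const hg)
    _ = _ := by
        rw [integral_add ((aux_meas_int Q b g).const_mul c) hc, integral_const_mul]
        simp [hb, mul_comm]

/-- if two probability measures `P, Q` satisfy the two-sided
`(ε,δ)`-indistinguishability conditions `P(S) ≤ e^ε Q(S) + δ` and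
`Q(S) ≤ e^ε P(S) + δ` for all measurable `S`, then for every measurable `f`
with `|f| ≤ b` everywhere,
`E_P[f] ≤ E_Q[f] + (e^ε − 1)·E_Q[|f|] + 2 δ b`. -/
theorem expectation_dp_transfer {Ω : Type*} [MeasurableSpace Ω]
    (P Q : Measure Ω) [IsProbabilityMeasure P] [IsProbabilityMeasure Q]
    (ε δ b : ℝ) (hε : 0 ≤ ε) (hδ : 0 ≤ δ) (hb : 0 ≤ b)
    (hPQ : ∀ S : Set Ω, MeasurableSet S →
      (P S).toReal ≤ Real.exp ε * (Q S).toReal + δ)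
    (hQP : ∀ S : Set Ω, MeasurableSet S →
      (Q S).toReal ≤ Real.exp ε * (P S).toReal + δ)
    (f : Ω → ℝ) (hf : Measurable f) (hfb : ∀ ω, |f ω| ≤ b) :
    ∫ ω, f ω ∂P ≤ ∫ ω, f ω ∂Q + (Real.exp ε - 1) * ∫ ω, |f ω| ∂Q + 2 * δ * b := by
  have hint : ∀ (ν : Measure Ω) [IsProbabilityMeasure ν] (g : Ω → ℝ), Measurable g →
      (∀ ω, |g ω| ≤ b) → Integrable g ν := by
    intro ν _ g hg hgb
    exact Integrable.of_bound hg.aestronglyMeasurable b (Filter.Eventually.of_forall hgb)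
  have hpm : Measurable (fun ω => max (f ω) 0) := hf.max measurable_const
  have hnm : Measurable (fun ω => max (-f ω) 0) := hf.neg.max measurable_const
  have hp0 : ∀ ω, 0 ≤ max (f ω) 0 := fun ω => le_max_right _ _
  have hn0 : ∀ ω, 0 ≤ max (-f ω) 0 := fun ω => le_max_right _ _
  have hpb : ∀ ω, max (f ω) 0 ≤ b := fun ω => max_le ((le_abs_self _).trans (hfb ω)) hb
  have hnb : ∀ ω, max (-f ω) 0 ≤ b := fun ω => max_le ((neg_le_abs _).trans (hfb ω)) hb
  have hpi : ∀ (ν : Measure Ω) [IsProbabilityMeasure ν],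
      Integrable (fun ω => max (f ω) 0) ν := fun ν _ =>
    hint ν _ hpm (fun ω => by rw [abs_of_nonneg (hp0 ω)]; exact hpb ω)
  have hni : ∀ (ν : Measure Ω) [IsProbabilityMeasure ν],
      Integrable (fun ω => max (-f ω) 0) ν := fun ν _ =>
    hint ν _ hnm (fun ω => by rw [abs_of_nonneg (hn0 ω)]; exact hnb ω)
  have hdec : ∀ (ν : Measure Ω) [IsProbabilityMeasure ν],
      ∫ ω, f ω ∂ν = ∫ ω, max (f ω) 0 ∂ν - ∫ ω, max (-f ω) 0 ∂ν := by
    intro ν _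
    rw [← integral_sub (hpi ν) (hni ν)]
    congr 1; ext ω; grind
  have habs : ∫ ω, |f ω| ∂Q = ∫ ω, max (f ω) 0 ∂Q + ∫ ω, max (-f ω) 0 ∂Q := by
    rw [← integral_add (hpi Q) (hni Q)]
    congr 1; ext ω; grind
  have h1 := aux_transfer P Q _ δ b hb hPQ _ hpm hp0 hpb (hpi P) (hpi Q)
  have h2 := aux_transfer Q P _ δ b hb hQP _ hnm hn0 hnb (hni Q) (hni P)
  have hB : 0 ≤ ∫ ω, max (-f ω) 0 ∂Q := integral_nonneg hn0
  rw [hdec P, hdec Q, habs]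
  generalize ∫ ω, max (f ω) 0 ∂P = pp at *
  generalize ∫ ω, max (f ω) 0 ∂Q = pq at *
  generalize ∫ ω, max (-f ω) 0 ∂P = np at *
  generalize ∫ ω, max (-f ω) 0 ∂Q = nq at *
  have hc : 1 ≤ Real.exp ε := Real.one_le_exp hε
  generalize Real.exp ε = c at *
  have hδb : 0 ≤ δ * b := mul_nonneg hδ hb
  suffices h : 0 ≤ c * (np - nq + (c - 1) * nq + δ * b) by
    have := nonneg_of_mul_nonneg_right h (by linarith)
    nlinarith
  nlinarith [mul_nonneg (sq_nonneg (c - 1)) hB, mul_nonneg (sub_nonneg.2 hc) hδb]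
end

section
/- In the tracing-attack setup, if in addition M is (ε,δ)-differentially private with 0 < ε ≤ 1 and δ ≥ 0, then the sum over i = 1,...,n of the expectations of Z_i satisfies Σᵢ E[Z_i] ≤ 4·n·α·ε + 8·n·δ·d. -/
open MeasureTheory ProbabilityTheory
open scoped NNReal ENNReal

/-- The uniform distribution on `[-1,1] ⊆ ℝ`. -/
noncomputable def uniformIcc : Measure ℝ :=
  ((2 : ℝ≥0))⁻¹ • (volume.restrict (Set.Icc (-1 : ℝ) 1))

instance : IsProbabilityMeasure uniformIcc := by
  constructor
  simp [uniformIcc, Measure.restrict_apply, Real.volume_Icc]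
  norm_num
  simp [ENNReal.smul_def, ENNReal.coe_inv, ENNReal.inv_mul_cancel]

/-- The uniform distribution on the cube `[-1,1]^d`. -/
noncomputable def uniformCube (d : ℕ) : Measure (Fin d → ℝ) :=
  Measure.pi fun _ => uniformIcc


lemma dp_int {R : Type*} [MeasurableSpace R] (P Q : Measure R) [IsProbabilityMeasure P]
    [IsProbabilityMeasure Q] (ε δ : ℝ) (hδ : 0 ≤ δ)
    (h : ∀ S : Set R, MeasurableSet S → P S ≤ ENNReal.ofReal (Real.exp ε) * Q S + ENNReal.ofReal δ)
    (g : R → ℝ) (hg : Measurable g) (B : ℝ) (h0 : ∀ y, 0 ≤ g y) (hB : ∀ y, g y ≤ B) (hB0 : 0 ≤ B) :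
    ∫ y, g y ∂P ≤ Real.exp ε * ∫ y, g y ∂Q + B * δ := by
  have hi : ∀ (P : Measure R) [IsProbabilityMeasure P], Integrable g P := fun P _ =>
    Integrable.of_bound hg.aestronglyMeasurable B
      (Filter.Eventually.of_forall fun y => by rw [Real.norm_eq_abs, abs_of_nonneg (h0 y)]; exact hB y)
  have hl : ∀ (P : Measure R) [IsProbabilityMeasure P],
      ∫ y, g y ∂P = ∫ t in Set.Ioc 0 B, P.real {a | t ≤ g a} := fun P _ =>
    (hi P).integral_eq_integral_Ioc_meas_le (Filter.Eventually.of_forall h0)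
      (Filter.Eventually.of_forall hB)
  have hm : ∀ (P : Measure R) [IsProbabilityMeasure P],
      IntegrableOn (fun t => P.real {a | t ≤ g a}) (Set.Ioc 0 B) := by
    intro P _
    refine Measure.integrableOn_of_bounded (M := 1) (by simp) ?_ ?_
    · refine (Antitone.measurable ?_).aestronglyMeasurable
      intro s t hst
      exact measureReal_mono fun a ha => le_trans hst ha
    · refine Filter.Eventually.of_forall fun t => ?_
      rw [Real.norm_eq_abs, abs_of_nonneg measureReal_nonneg]
      exact measureReal_le_one
  have hS : ∀ S : Set R, MeasurableSet S → P.real S ≤ Real.exp ε * Q.real S + δ := by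
    intro S hS
    have := ENNReal.toReal_mono (by finiteness) (h S hS)
    rw [ENNReal.toReal_add (by finiteness) (by finiteness), ENNReal.toReal_mul,
      ENNReal.toReal_ofReal hδ, ENNReal.toReal_ofReal (Real.exp_pos ε).le] at this
    exact this
  rw [hl P, hl Q]
  calc _ ≤ ∫ t in Set.Ioc 0 B, (Real.exp ε * Q.real {a | t ≤ g a} + δ) := by
        refine integral_mono (hm P) (((hm Q).const_mul _).add (integrable_const _)) fun t => ?_
        exact hS _ (measurableSet_le measurable_const hg)
    _ = _ := by
        rw [integral_add ((hm Q).const_mul _) (integrable_const _), integral_const_mul]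
        simp [hB0]

lemma dp_signed {R : Type*} [MeasurableSpace R] (P Q : Measure R) [IsProbabilityMeasure P]
    [IsProbabilityMeasure Q] (ε δ : ℝ) (hε : 0 < ε) (hε1 : ε ≤ 1) (hδ : 0 ≤ δ)
    (h : ∀ S : Set R, MeasurableSet S → P S ≤ ENNReal.ofReal (Real.exp ε) * Q S + ENNReal.ofReal δ)
    (h' : ∀ S : Set R, MeasurableSet S → Q S ≤ ENNReal.ofReal (Real.exp ε) * P S + ENNReal.ofReal δ)
    (f : R → ℝ) (hf : Measurable f) (B : ℝ) (hB : ∀ y, |f y| ≤ B) (hB0 : 0 ≤ B) (c : ℝ) (hc : 0 < c) :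
    ∫ y, f y ∂P ≤ Real.cosh ε * ∫ y, f y ∂Q + 2 * ε * ((∫ y, f y ^ 2 ∂Q) / (2 * c) + c / 2)
      + 2 * B * δ := by
  have hi : ∀ (P : Measure R) [IsProbabilityMeasure P], Integrable f P := fun P _ =>
    Integrable.of_bound hf.aestronglyMeasurable B (Filter.Eventually.of_forall hB)
  have hi2 : Integrable (fun y => f y ^ 2) Q := 
    Integrable.of_bound (hf.pow_const 2).aestronglyMeasurable (B ^ 2)
      (Filter.Eventually.of_forall fun y => by
        rw [Real.norm_eq_abs, abs_pow]; exact pow_le_pow_left₀ (abs_nonneg _) (hB y) 2)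
  have hp := dp_int P Q ε δ hδ h (fun y => (|f y| + f y) / 2) (by fun_prop) B
    (fun y => by have := neg_abs_le (f y); linarith)
    (fun y => by have := le_abs_self (f y); have := hB y; linarith) hB0
  have hn := dp_int Q P ε δ hδ h' (fun y => (|f y| - f y) / 2) (by fun_prop) B
    (fun y => by have := le_abs_self (f y); linarith)
    (fun y => by have := neg_abs_le (f y); have := hB y; linarith) hB0
  rw [integral_div, integral_div, integral_add (hi P).abs (hi P), integral_add (hi Q).abs (hi Q)] at hp
  rw [integral_div, integral_div, integral_sub (hi P).abs (hi P), integral_sub (hi Q).abs (hi Q)] at hn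
  have hsq : ∫ y, |f y| ∂Q ≤ (∫ y, f y ^ 2 ∂Q) / (2 * c) + c / 2 := by
    have : ∫ y, |f y| ∂Q ≤ ∫ y, (f y ^ 2 / (2 * c) + c / 2) ∂Q := by
      refine integral_mono (hi Q).abs ((hi2.div_const _).add (integrable_const _)) fun y => ?_
      have : f y ^ 2 / (2 * c) + c / 2 - |f y| = (|f y| - c) ^ 2 / (2 * c) := by
        rw [← sq_abs]; field_simp; ring
      have : 0 ≤ (|f y| - c) ^ 2 / (2 * c) := by positivity
      simp only
      linarith
    rwa [integral_add (hi2.div_const _) (integrable_const _), integral_div, integral_const, 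
      probReal_univ, one_smul] at this
  have habs : 0 ≤ ∫ y, |f y| ∂Q := integral_nonneg fun y => abs_nonneg _
  have hsinh : Real.sinh ε ≤ 2 * ε := by
    rw [Real.sinh_eq]
    have h1 := Real.exp_bound' hε.le hε1 (n := 2) (by norm_num)
    have h2 := Real.one_sub_le_exp_neg ε
    simp [Finset.sum_range_succ] at h1
    nlinarith
  have e1 : Real.exp (-ε) * Real.exp ε = 1 := by rw [← Real.exp_add]; simp
  have e2 : Real.exp (-ε) ≤ 1 := by simpa using hε.le
  have e3 := Real.exp_pos (-ε)
  have hn2 := mul_le_mul_of_nonneg_left hn e3.le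
  have hmul := mul_le_mul hsinh hsq habs (by linarith)
  have key : ∫ y, f y ∂P ≤ Real.cosh ε * ∫ y, f y ∂Q + Real.sinh ε * ∫ y, |f y| ∂Q + 2 * B * δ := by
    rw [Real.sinh_eq, Real.cosh_eq]
    have hbd : Real.exp (-ε) * (B * δ) ≤ B * δ := mul_le_of_le_one_left (by positivity) e2
    rw [mul_add, ← mul_assoc, e1] at hn2
    linarith
  linarith

lemma bern_prob {p : ℝ} (hp : p ∈ Set.Icc (-1 : ℝ) 1) : IsProbabilityMeasure (bernSign p) := by
  constructor
  have h1 : 0 ≤ (1 + p) / 2 := by linarith [hp.1]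
  have h2 : 0 ≤ (1 - p) / 2 := by linarith [hp.2]
  simp only [bernSign, Measure.add_apply, Measure.smul_apply, measure_univ, ENNReal.smul_def]
  simp only [smul_eq_mul, mul_one]
  rw [← ENNReal.coe_add, ← Real.toNNReal_add h1 h2]
  ring_nf
  simp

lemma bern_int {p : ℝ} (hp : p ∈ Set.Icc (-1 : ℝ) 1) (g : Bool → ℝ) :
    ∫ b, g b ∂(bernSign p) = (1 + p) / 2 * g true + (1 - p) / 2 * g false := by
  have h1 : 0 ≤ (1 + p) / 2 := by linarith [hp.1]
  have h2 : 0 ≤ (1 - p) / 2 := by linarith [hp.2]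
  rw [bernSign, integral_add_measure Integrable.of_finite Integrable.of_finite,
    integral_smul_nnreal_measure, integral_smul_nnreal_measure, integral_dirac, integral_dirac]
  simp [NNReal.smul_def, h1, h2]

lemma resample {B : Type*} [MeasurableSpace B] {n : ℕ} (P : Measure B)
    [IsProbabilityMeasure P] (i : Fin n) :
    ((Measure.pi fun _ : Fin n => P).prod P).map (fun q => Function.update q.1 i q.2)
      = Measure.pi fun _ : Fin n => P := by
  symm
  refine Measure.pi_eq fun s hs => ?_
  rw [Measure.map_apply (by fun_prop) (MeasurableSet.univ_pi hs)]
  have : (fun q : (Fin n → B) × B => Function.update q.1 i q.2) ⁻¹' Set.univ.pi s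
      = (Set.univ.pi (Function.update s i Set.univ)) ×ˢ s i := by
    ext ⟨Y, x⟩
    simp only [Set.mem_preimage, Set.mem_pi, Set.mem_univ, true_imp_iff, Set.mem_prod]
    constructor
    · intro h
      refine ⟨fun j => ?_, by simpa using h i⟩
      by_cases hj : j = i
      · subst hj; simp
      · simpa [hj] using h j
    · rintro ⟨h1, h2⟩ j
      by_cases hj : j = i
      · subst hj; simpa using h2
      · simpa [hj] using h1 j
  rw [this, Measure.prod_prod, Measure.pi_pi]
  rw [← Finset.mul_prod_erase _ _ (Finset.mem_univ i), ← Finset.mul_prod_erase _ (fun j => P (s j)) (Finset.mem_univ i)]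
  simp only [Function.update_self, measure_univ, one_mul]
  rw [mul_comm]
  congr 1
  refine Finset.prod_congr rfl fun j hj => ?_
  rw [Function.update_of_ne (Finset.ne_of_mem_erase hj)]

lemma pprod_prob {d : ℕ} {μ : Fin d → ℝ} (hμ : ∀ j, μ j ∈ Set.Icc (-1 : ℝ) 1) :
    IsProbabilityMeasure (Pprod μ) := by
  have := fun j => bern_prob (hμ j)
  unfold Pprod; infer_instance

lemma pprod_mean {d : ℕ} {μ : Fin d → ℝ} (hμ : ∀ j, μ j ∈ Set.Icc (-1 : ℝ) 1) (a : Fin d → ℝ) :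
    ∫ x, ∑ j, a j * (signB (x j) - μ j) ∂(Pprod μ) = 0 := by
  have := fun j => bern_prob (hμ j)
  rw [integral_finsetSum _ fun j _ => Integrable.of_finite]
  refine Finset.sum_eq_zero fun j _ => ?_
  have := integral_map (μ := Pprod μ) (φ := fun x : Fin d → Bool => x j)
    (measurable_pi_apply j).aemeasurable
    (f := fun b => a j * (signB b - μ j)) (Measurable.of_discrete.aestronglyMeasurable)
  rw [← this, Pprod, (measurePreserving_eval _ j).map_eq, bern_int (hμ j)]
  simp [signB]; ring

lemma pprod_sq {d : ℕ} {μ : Fin d → ℝ} (hμ : ∀ j, μ j ∈ Set.Icc (-1 : ℝ) 1) (a : Fin d → ℝ) :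
    ∫ x, (∑ j, a j * (signB (x j) - μ j)) ^ 2 ∂(Pprod μ) ≤ ∑ j, a j ^ 2 := by
  have := fun j => bern_prob (hμ j)
  rw [← variance_of_integral_eq_zero (Measurable.of_discrete.aemeasurable) (pprod_mean hμ a)]
  have h := variance_sum_pi (μ := fun j => bernSign (μ j))
    (X := fun j b => a j * (signB b - μ j)) (fun j => MemLp.of_discrete)
  have e : (∑ j, fun x : Fin d → Bool => a j * (signB (x j) - μ j))
    = fun x => ∑ j, a j * (signB (x j) - μ j) := by ext x; simp
  rw [e] at h
  rw [Pprod, h]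
  refine Finset.sum_le_sum fun j _ => ?_
  have h0 : ∫ b, a j * (signB b - μ j) ∂(bernSign (μ j)) = 0 := by
    rw [bern_int (hμ j)]; simp [signB]; ring
  rw [variance_of_integral_eq_zero (Measurable.of_discrete.aemeasurable) h0, bern_int (hμ j)]
  simp [signB]
  nlinarith [mul_nonneg (sq_nonneg (a j)) (sq_nonneg (μ j))]

lemma pointwise (n d : ℕ) (ε δ : ℝ)
    (hε : 0 < ε) (hε1 : ε ≤ 1) (hδ : 0 ≤ δ)
    (M : (Fin n → (Fin d → Bool)) → Measure (Fin d → Set.Icc (-1 : ℝ) 1))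
    (hM : ∀ X, IsProbabilityMeasure (M X))
    (hDP : DPriv M ε δ) (i : Fin n) (c : ℝ) (hc : 0 < c)
    (μ : Fin d → ℝ) (hμ : ∀ j, μ j ∈ Set.Icc (-1 : ℝ) 1) :
    ∫ X, ∫ y, ∑ j, ((y j : ℝ) - μ j) * (signB (X i j) - μ j)
        ∂(M X) ∂(Measure.pi fun _ : Fin n => Pprod μ) ≤
    2 * ε * ((∫ X, ∫ y, ∑ j, ((y j : ℝ) - μ j) ^ 2
      ∂(M X) ∂(Measure.pi fun _ : Fin n => Pprod μ)) / (2 * c) + c / 2) + 8 * δ * d := by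
  have := pprod_prob hμ
  have hab : ∀ (y : Set.Icc (-1 : ℝ) 1) j, |(y : ℝ) - μ j| ≤ 2 := fun y j => by
    rw [abs_le]; constructor <;> linarith [y.2.1, y.2.2, (hμ j).1, (hμ j).2]
  have hsb : ∀ b j, |signB b - μ j| ≤ 2 := fun b j => by
    rw [abs_le]; cases b <;> simp [signB] <;> constructor <;> linarith [(hμ j).1, (hμ j).2]
  let f : (Fin d → Bool) → (Fin d → Set.Icc (-1 : ℝ) 1) → ℝ :=
    fun x y => ∑ j, ((y j : ℝ) - μ j) * (signB (x j) - μ j)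
  have hfm : ∀ x, Measurable (f x) := fun x => by fun_prop
  have hfB : ∀ x y, |f x y| ≤ 4 * d := fun x y => by
    refine (Finset.abs_sum_le_sum_abs _ _).trans ?_
    refine (Finset.sum_le_card_nsmul _ _ 4 fun j _ => ?_).trans (by simp [mul_comm])
    rw [abs_mul]
    have := mul_le_mul (hab (y j) j) (hsb (x j) j) (abs_nonneg _) (by norm_num)
    linarith
  have hfi : ∀ x Y, Integrable (f x) (M Y) := fun x Y =>
    Integrable.of_bound (hfm x).aestronglyMeasurable (4 * d) (Filter.Eventually.of_forall (hfB x))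
  have hfi2 : ∀ x Y, Integrable (fun y => f x y ^ 2) (M Y) := fun x Y =>
    Integrable.of_bound ((hfm x).pow_const 2).aestronglyMeasurable ((4 * d) ^ 2)
      (Filter.Eventually.of_forall fun y => by
        rw [Real.norm_eq_abs, abs_pow]; exact pow_le_pow_left₀ (abs_nonneg _) (hfB x y) 2)
  have hsi : ∀ Y, Integrable (fun y : Fin d → Set.Icc (-1 : ℝ) 1 => ∑ j, ((y j : ℝ) - μ j) ^ 2) (M Y) := by
    intro Y
    refine integrable_finsetSum _ fun j _ => ?_
    refine Integrable.of_bound (Measurable.aestronglyMeasurable (by fun_prop)) (2 ^ 2) (Filter.Eventually.of_forall fun y => ?_)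
    rw [Real.norm_eq_abs, abs_pow]; exact pow_le_pow_left₀ (abs_nonneg _) (hab (y j) j) 2
  have hswap : ∀ (Y) (g : (Fin d → Bool) → (Fin d → Set.Icc (-1 : ℝ) 1) → ℝ),
      (∀ x, Integrable (g x) (M Y)) →
      ∫ x, ∫ y, g x y ∂(M Y) ∂(Pprod μ) = ∫ y, ∫ x, g x y ∂(Pprod μ) ∂(M Y) := by
    intro Y g hg
    simp_rw [integral_fintype (Integrable.of_finite (μ := Pprod μ)), smul_eq_mul]
    rw [integral_finsetSum _ fun x _ => (hg x).const_mul _]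
    simp_rw [integral_const_mul]
  rw [← resample (Pprod μ) i, integral_map (by fun_prop) (by fun_prop), resample,
    integral_prod _ Integrable.of_finite]
  have hR : 2 * ε * ((∫ X, ∫ y, ∑ j, ((y j : ℝ) - μ j) ^ 2
      ∂(M X) ∂(Measure.pi fun _ : Fin n => Pprod μ)) / (2 * c) + c / 2) + 8 * δ * d
      = ∫ X, (2 * ε * ((∫ y, ∑ j, ((y j : ℝ) - μ j) ^ 2
      ∂(M X)) / (2 * c) + c / 2) + 8 * δ * d) ∂(Measure.pi fun _ : Fin n => Pprod μ) := by
    rw [integral_add Integrable.of_finite Integrable.of_finite, integral_const_mul,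
      integral_add Integrable.of_finite Integrable.of_finite, integral_div]
    simp
  rw [hR]
  refine integral_mono Integrable.of_finite Integrable.of_finite fun Y => ?_
  simp only [Function.update_self]
  have hstep : ∀ x, ∫ y, f x y ∂(M (Function.update Y i x)) ≤
      Real.cosh ε * ∫ y, f x y ∂(M Y) + 2 * ε * ((∫ y, f x y ^ 2 ∂(M Y)) / (2 * c) + c / 2)
      + 2 * (4 * d) * δ := by
    intro x
    refine dp_signed _ _ ε δ hε hε1 hδ (hDP _ _ ⟨i, fun k hk => by simp [hk]⟩)
      (hDP _ _ ⟨i, fun k hk => by simp [hk]⟩) (f x) (hfm x) (4 * d) (hfB x) (by positivity) c hc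
  refine (integral_mono (μ := Pprod μ) Integrable.of_finite Integrable.of_finite hstep).trans ?_
  rw [integral_add Integrable.of_finite Integrable.of_finite,
    integral_add Integrable.of_finite Integrable.of_finite, integral_const_mul, integral_const_mul,
      integral_add Integrable.of_finite Integrable.of_finite, integral_div,
      hswap Y f (fun x => hfi x Y), hswap Y (fun x y => f x y ^ 2) (fun x => hfi2 x Y)]
  have h1 : ∫ y, ∫ x, f x y ∂(Pprod μ) ∂(M Y) = 0 := by
    rw [← integral_zero (Fin d → Set.Icc (-1 : ℝ) 1) ℝ (μ := M Y)]
    congr 1; ext y; exact pprod_mean hμ _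
  have h2 : ∫ y, ∫ x, f x y ^ 2 ∂(Pprod μ) ∂(M Y) ≤ ∫ y, ∑ j, ((y j : ℝ) - μ j) ^ 2 ∂(M Y) := by
    refine integral_mono ?_ (hsi Y) fun y => pprod_sq hμ _
    simp_rw [integral_fintype (Integrable.of_finite (μ := Pprod μ)), smul_eq_mul]
    exact integrable_finsetSum _ fun x _ => (hfi2 x Y).const_mul _
  rw [h1]
  simp only [integral_const, probReal_univ, one_smul, mul_zero, zero_add]
  have : 2 * (4 * (d : ℝ)) * δ = 8 * δ * d := by ring
  rw [this]
  gcongr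

lemma ae_cube (d : ℕ) : ∀ᵐ μ ∂(uniformCube d), ∀ j, μ j ∈ Set.Icc (-1 : ℝ) 1 := by
  rw [ae_all_iff]
  intro j
  have h : ∀ᵐ t ∂uniformIcc, t ∈ Set.Icc (-1 : ℝ) 1 := by
    unfold uniformIcc
    exact Measure.ae_smul_measure (ae_restrict_mem measurableSet_Icc) _
  exact (measurePreserving_eval (fun _ : Fin d => uniformIcc) j).quasiMeasurePreserving.ae h

instance (d : ℕ) : IsProbabilityMeasure (uniformCube d) := by
  unfold uniformCube; infer_instance

lemma bern_single (p : ℝ) (b : Bool) :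
    (bernSign p).real {b} = max ((1 + signB b * p) / 2) 0 := by
  cases b <;> simp [bernSign, signB, measureReal_def, sub_eq_add_neg]

lemma A_integrable (n d : ℕ) (M : (Fin n → (Fin d → Bool)) → Measure (Fin d → Set.Icc (-1 : ℝ) 1))
    (hM : ∀ X, IsProbabilityMeasure (M X)) :
    Integrable (fun μ => ∫ X, ∫ y, ∑ j, ((y j : ℝ) - μ j) ^ 2
      ∂(M X) ∂(Measure.pi fun _ : Fin n => Pprod μ)) (uniformCube d) := by
  refine Integrable.of_bound (C := 4 * d) ?_ ?_
  · simp_rw [integral_fintype (Integrable.of_finite (μ := Measure.pi _)), smul_eq_mul]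
    refine Measurable.aestronglyMeasurable ?_
    refine Finset.measurable_sum _ fun X _ => ?_
    refine Measurable.mul ?_ ?_
    · have : ∀ μ : Fin d → ℝ, (Measure.pi fun _ : Fin n => Pprod μ).real {X}
          = ∏ i, ∏ j, max ((1 + signB (X i j) * μ j) / 2) 0 := by
        intro μ
        simp_rw [← bern_single, measureReal_def, Measure.pi_singleton, Pprod, Measure.pi_singleton,
          ENNReal.toReal_prod]
      simp_rw [this]
      fun_prop
    · refine StronglyMeasurable.measurable ?_
      refine StronglyMeasurable.integral_prod_right ?_
      refine Measurable.stronglyMeasurable ?_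
      simp only [Function.uncurry_def]
      fun_prop
  · filter_upwards [ae_cube d] with μ hμ
    have := pprod_prob hμ
    refine (norm_integral_le_of_norm_le_const (C := 4 * d) (Filter.Eventually.of_forall fun X => ?_)).trans (by simp)
    refine (norm_integral_le_of_norm_le_const (C := 4 * d) (Filter.Eventually.of_forall fun y => ?_)).trans (by simp)
    rw [Real.norm_eq_abs, abs_of_nonneg (by positivity)]
    refine (Finset.sum_le_card_nsmul _ _ 4 fun j _ => ?_).trans (by simp [mul_comm])
    have hab : |(y j : ℝ) - μ j| ≤ 2 := by
      rw [abs_le]; constructor <;> linarith [(y j).2.1, (y j).2.2, (hμ j).1, (hμ j).2]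
    rw [← sq_abs]
    nlinarith [abs_nonneg ((y j : ℝ) - μ j)]

lemma affine_int {Ω : Type*} [MeasurableSpace Ω] (P : Measure Ω) [IsProbabilityMeasure P]
    (A : Ω → ℝ) (hA : Integrable A P) (k p q r : ℝ) :
    Integrable (fun t => k * (A t / p + q) + r) P ∧
    ∫ t, (k * (A t / p + q) + r) ∂P = k * ((∫ t, A t ∂P) / p + q) + r := by
  have h1 : Integrable (fun t => A t / p + q) P := (hA.div_const _).add (integrable_const _)
  have h2 : Integrable (fun t => k * (A t / p + q)) P := h1.const_mul k
  refine ⟨h2.add (integrable_const _), ?_⟩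
  rw [integral_add h2 (integrable_const _), integral_const_mul,
    integral_add (hA.div_const _) (integrable_const _), integral_div]
  simp

/-- in the tracing-attack setup, if moreover `M` is
`(ε,δ)`-differentially private with `0 < ε ≤ 1` and `δ ≥ 0`, then
`Σᵢ E[Z_i] ≤ 4 n α ε + 8 n δ d`, where `Z_i = ⟨M(X) − μ, X_i − μ⟩`. -/
theorem tracing_sum_Z_upper_bound (n d : ℕ) (ε δ : ℝ)
    (hε : 0 < ε) (hε1 : ε ≤ 1) (hδ : 0 ≤ δ)
    (M : (Fin n → (Fin d → Bool)) → Measure (Fin d → Set.Icc (-1 : ℝ) 1))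
    (hM : ∀ X, IsProbabilityMeasure (M X))
    (hDP : DPriv M ε δ)
    (α : ℝ) (hα0 : 0 ≤ α)
    (hα : α ^ 2 = ∫ μ, ∫ X, ∫ y, ∑ j, ((y j : ℝ) - μ j) ^ 2
      ∂(M X) ∂(Measure.pi fun _ : Fin n => Pprod μ) ∂(uniformCube d)) :
    (∑ i : Fin n, ∫ μ, ∫ X, ∫ y, ∑ j, ((y j : ℝ) - μ j) * (signB (X i j) - μ j)
        ∂(M X) ∂(Measure.pi fun _ : Fin n => Pprod μ) ∂(uniformCube d))
      ≤ 4 * n * α * ε + 8 * n * δ * d := by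
  have main : ∀ i : Fin n, ∫ μ, ∫ X, ∫ y, ∑ j, ((y j : ℝ) - μ j) * (signB (X i j) - μ j)
        ∂(M X) ∂(Measure.pi fun _ : Fin n => Pprod μ) ∂(uniformCube d)
        ≤ 4 * α * ε + 8 * δ * d := by
    intro i
    by_cases hint : Integrable (fun μ => ∫ X, ∫ y, ∑ j, ((y j : ℝ) - μ j) * (signB (X i j) - μ j)
        ∂(M X) ∂(Measure.pi fun _ : Fin n => Pprod μ)) (uniformCube d)
    swap
    · rw [integral_undef hint]; positivity
    refine le_of_forall_pos_le_add fun η hη => ?_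
    have hA := A_integrable n d M hM
    have hc : 0 < α + η := by linarith
    obtain ⟨hI, hE⟩ := affine_int (uniformCube d) _ hA (2 * ε) (2 * (α + η)) ((α + η) / 2)
      (8 * δ * d)
    rw [← hα] at hE
    refine (integral_mono_ae hint hI ?_).trans ?_
    · filter_upwards [ae_cube d] with μ hμ
      exact pointwise n d ε δ hε hε1 hδ M hM hDP i (α + η) hc μ hμ
    rw [hE]
    have h2 : α ^ 2 / (2 * (α + η)) ≤ α / 2 := by
      rw [div_le_div_iff₀ (by positivity) (by norm_num)]
      nlinarith [mul_nonneg hα0 hη.le]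
    nlinarith [mul_nonneg hα0 hε.le, mul_le_mul_of_nonneg_left h2 hε.le, mul_le_mul_of_nonneg_right hε1 hη.le]
  refine (Finset.sum_le_card_nsmul _ _ _ fun i _ => main i).trans (le_of_eq ?_)
  simp
  ring
end

section
/- There is a universal constant C > 0 such that for every d ≥ 1 with D = 2^d, every n ∈ ℕ, every 0 < ε ≤ 1, and every 0 < δ < 1, there exists an (ε,δ)-differentially private mechanism M from {1,...,D}^n to probability measures on ℝ^D such that for every probability distribution P on {1,...,D}, the expectation over X₁,...,Xₙ drawn i.i.d. from P and over the randomness of M of max_{1≤j≤D} |M(X)_j − Φ_P(j)| is at most C·( √(1/n) + (log D)^{3/2} · √(log(1/δ)) / (ε·n) ). -/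
open MeasureTheory ProbabilityTheory

lemma gauss_mgf {V : Type*} [Fintype V] (s : NNReal) (t : V → ℝ) :
    Integrable (fun y : V → ℝ => Real.exp (∑ v, t v * y v))
      (Measure.pi fun _ : V => gaussianReal 0 s) ∧
    ∫ y : V → ℝ, Real.exp (∑ v, t v * y v) ∂(Measure.pi fun _ : V => gaussianReal 0 s)
      = Real.exp (s * (∑ v, t v ^ 2) / 2) := by
  simp_rw [Real.exp_sum]
  constructor
  · exact Integrable.fintype_prod (f := fun v (y : ℝ) => Real.exp (t v * y))
      (fun v => integrable_exp_mul_gaussianReal (t v))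
  · rw [integral_fintype_prod_eq_prod (fun v (y : ℝ) => Real.exp (t v * y))]
    have h : ∀ v, ∫ y : ℝ, Real.exp (t v * y) ∂(gaussianReal 0 s) = Real.exp (s * t v ^ 2 / 2) := by
      intro v
      have := congrFun (mgf_id_gaussianReal (μ := 0) (v := s)) (t v)
      simp only [mgf, id] at this
      rw [this]; ring_nf
    simp_rw [h]
    rw [← Real.exp_sum, Finset.mul_sum, Finset.sum_div]

lemma gauss_density (s : NNReal) (hs : s ≠ 0) (u : ℝ) :
    gaussianReal u s = (gaussianReal 0 s).withDensity
      (fun y => ENNReal.ofReal (Real.exp (u / s * y - u ^ 2 / (2 * s)))) := by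
  rw [gaussianReal_of_var_ne_zero _ hs, gaussianReal_of_var_ne_zero _ hs,
    ← withDensity_mul _ (measurable_gaussianPDF 0 s) (by fun_prop)]
  congr 1
  ext y
  simp only [Pi.mul_apply, gaussianPDF]
  rw [← ENNReal.ofReal_mul (gaussianPDFReal_nonneg _ _ _)]
  congr 1
  simp only [gaussianPDFReal]
  rw [mul_assoc (√(2 * Real.pi * (s : ℝ)))⁻¹, ← Real.exp_add]
  congr 2
  have : (s : ℝ) ≠ 0 := by exact_mod_cast hs
  field_simp
  ring

lemma gauss_density_pi {V : Type*} [Fintype V] (s : NNReal) (hs : s ≠ 0) (u : V → ℝ) :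
    (Measure.pi fun v : V => gaussianReal (u v) s) =
      (Measure.pi fun _ : V => gaussianReal 0 s).withDensity
      (fun y => ENNReal.ofReal (Real.exp (∑ v, (u v / s * y v - u v ^ 2 / (2 * s))))) := by
  refine Measure.pi_eq fun S hS => ?_
  rw [withDensity_apply _ (MeasurableSet.univ_pi hS), Measure.restrict_pi_pi]
  have hi : ∀ v, Integrable (fun y : ℝ => Real.exp (u v / s * y - u v ^ 2 / (2 * s)))
      ((gaussianReal 0 s).restrict (S v)) := by
    intro v
    refine Integrable.restrict ?_
    simp_rw [sub_eq_add_neg, Real.exp_add]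
    exact (integrable_exp_mul_gaussianReal _).mul_const _
  simp_rw [Real.exp_sum]
  rw [← ofReal_integral_eq_lintegral_ofReal (Integrable.fintype_prod
      (f := fun v (y : ℝ) => Real.exp (u v / s * y - u v ^ 2 / (2 * s))) hi)
      (Filter.Eventually.of_forall fun y => Finset.prod_nonneg fun v _ => (Real.exp_pos _).le),
    integral_fintype_prod_eq_prod (fun v (y : ℝ) => Real.exp (u v / s * y - u v ^ 2 / (2 * s))),
    ENNReal.ofReal_prod_of_nonneg (fun v _ => integral_nonneg fun y => (Real.exp_pos _).le)]
  refine Finset.prod_congr rfl fun v _ => ?_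
  rw [ofReal_integral_eq_lintegral_ofReal (hi v)
    (Filter.Eventually.of_forall fun y => (Real.exp_pos _).le), gauss_density s hs (u v),
    withDensity_apply _ (hS v)]

lemma gauss_dp {V : Type*} [Fintype V] (s : NNReal) (hs : s ≠ 0) (u : V → ℝ) (ε lam : ℝ)
    (hl : 0 ≤ lam) (S : Set (V → ℝ)) (hS : MeasurableSet S) :
    (Measure.pi fun v : V => gaussianReal (u v) s) S ≤
      ENNReal.ofReal (Real.exp ε) * (Measure.pi fun _ : V => gaussianReal 0 s) S +
      ENNReal.ofReal (Real.exp (-lam * ε + (1 + lam) * lam * ((∑ v, u v ^ 2) / (2 * s)))) := by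
  have hs' : (s : ℝ) ≠ 0 := by exact_mod_cast hs
  set γ := (Measure.pi fun _ : V => gaussianReal 0 s) with hγ
  set L : (V → ℝ) → ℝ := fun y => ∑ v, (u v / s * y v - u v ^ 2 / (2 * s)) with hL
  have hLm : Measurable L := by fun_prop
  rw [gauss_density_pi s hs u, withDensity_apply _ hS]
  have key : ∀ y, ENNReal.ofReal (Real.exp (L y)) ≤
      ENNReal.ofReal (Real.exp ε) + ENNReal.ofReal (Real.exp (L y + lam * (L y - ε))) := by
    intro y
    rcases le_total (L y) ε with h | h
    · exact le_add_right (ENNReal.ofReal_le_ofReal (Real.exp_le_exp.2 h))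
    · refine le_add_left (ENNReal.ofReal_le_ofReal (Real.exp_le_exp.2 ?_))
      have := mul_nonneg hl (sub_nonneg.2 h)
      linarith
  have heq : ∀ y, Real.exp (L y + lam * (L y - ε)) =
      Real.exp (-lam * ε - (1 + lam) * ((∑ v, u v ^ 2) / (2 * s))) *
        Real.exp (∑ v, ((1 + lam) * (u v / s)) * y v) := by
    intro y
    rw [← Real.exp_add]
    congr 1
    simp only [hL, Finset.sum_sub_distrib, ← Finset.sum_div, mul_assoc, ← Finset.mul_sum]
    ring
  obtain ⟨hi, hv⟩ := gauss_mgf s (fun v => (1 + lam) * (u v / s))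
  calc ∫⁻ y in S, ENNReal.ofReal (Real.exp (L y)) ∂γ
      ≤ ∫⁻ y in S, (ENNReal.ofReal (Real.exp ε) +
          ENNReal.ofReal (Real.exp (L y + lam * (L y - ε)))) ∂γ := lintegral_mono key
    _ = ENNReal.ofReal (Real.exp ε) * γ S +
          ∫⁻ y in S, ENNReal.ofReal (Real.exp (L y + lam * (L y - ε))) ∂γ := by
        rw [lintegral_add_left measurable_const, setLIntegral_const]
    _ ≤ ENNReal.ofReal (Real.exp ε) * γ S +
          ∫⁻ y, ENNReal.ofReal (Real.exp (L y + lam * (L y - ε))) ∂γ := by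
        gcongr
        exact Measure.restrict_le_self
    _ = _ := by
        congr 1
        simp_rw [heq]
        rw [← ofReal_integral_eq_lintegral_ofReal (hi.const_mul _)
          (Filter.Eventually.of_forall fun y => by positivity), integral_const_mul, hv,
          ← Real.exp_add]
        congr 2
        simp_rw [mul_pow, div_pow]
        rw [← Finset.mul_sum, ← Finset.sum_div]
        field_simp
        ring

/-- expected maximum of linear forms of Gaussians -/
lemma gauss_max {V J : Type*} [Fintype V] [Fintype J] [Nonempty J] (s : NNReal) (hs : s ≠ 0)
    (t : J → V → ℝ) (B : ℝ) (hB : ∀ j, ∑ v, t j v ^ 2 ≤ B) :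
    Integrable (fun y : V → ℝ => ‖fun j => ∑ v, t j v * y v‖)
      (Measure.pi fun _ : V => gaussianReal 0 s) ∧
    ∫ y : V → ℝ, ‖fun j => ∑ v, t j v * y v‖ ∂(Measure.pi fun _ : V => gaussianReal 0 s)
      ≤ Real.sqrt s * (Real.log (2 * Fintype.card J) + B / 2) := by
  set γ := (Measure.pi fun _ : V => gaussianReal 0 s) with hγ
  have hs0 : (0 : ℝ) < s := by positivity
  set lam : ℝ := 1 / Real.sqrt s with hlam
  have hlpos : 0 < lam := by positivity
  have hl2 : (s : ℝ) * lam ^ 2 = 1 := by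
    rw [hlam, div_pow, Real.sq_sqrt hs0.le]; field_simp
  set K : ℝ := 2 * Fintype.card J * Real.exp (B / 2) with hK
  have hJ : (0 : ℝ) < Fintype.card J := by exact_mod_cast Fintype.card_pos
  have hKpos : 0 < K := by positivity
  set E : (V → ℝ) → ℝ := fun y => ∑ j, (Real.exp (∑ v, (lam * t j v) * y v) +
    Real.exp (∑ v, (-lam * t j v) * y v)) with hE
  have hEi : Integrable E γ := by
    refine integrable_finsetSum _ fun j _ => ?_
    exact (gauss_mgf s (fun v => lam * t j v)).1.add (gauss_mgf s (fun v => -lam * t j v)).1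
  have hEv : ∫ y, E y ∂γ ≤ K := by
    simp only [hE]
    rw [integral_finsetSum _ (f := fun j (y : V → ℝ) => Real.exp (∑ v, (lam * t j v) * y v) +
        Real.exp (∑ v, (-lam * t j v) * y v)) (fun j _ => (gauss_mgf s (fun v => lam * t j v)).1.add
      (gauss_mgf s (fun v => -lam * t j v)).1)]
    have : ∀ j ∈ Finset.univ, ∫ y : V → ℝ, (Real.exp (∑ v, (lam * t j v) * y v) +
        Real.exp (∑ v, (-lam * t j v) * y v)) ∂γ ≤ 2 * Real.exp (B / 2) := by
      intro j _
      rw [integral_add (gauss_mgf s (fun v => lam * t j v)).1 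
        (gauss_mgf s (fun v => -lam * t j v)).1, (gauss_mgf s (fun v => lam * t j v)).2,
        (gauss_mgf s (fun v => -lam * t j v)).2]
      have h1 : (s : ℝ) * ∑ v, (lam * t j v) ^ 2 = ∑ v, t j v ^ 2 := by
        simp_rw [mul_pow]; rw [← Finset.mul_sum, ← mul_assoc, hl2, one_mul]
      have h2 : (s : ℝ) * ∑ v, (-lam * t j v) ^ 2 = ∑ v, t j v ^ 2 := by
        simp_rw [mul_pow, neg_sq]; rw [← Finset.mul_sum, ← mul_assoc, hl2, one_mul]
      rw [h1, h2]
      have := Real.exp_le_exp.2 (div_le_div_of_nonneg_right (hB j) (by norm_num : (0:ℝ) ≤ 2))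
      linarith
    refine (Finset.sum_le_sum this).trans ?_
    simp [hK]; ring_nf; rfl
  have hpt : ∀ y : V → ℝ, ‖fun j => ∑ v, t j v * y v‖ ≤ 
      Real.sqrt s * (Real.log K + E y / K - 1) := by
    intro y
    have hx : ∀ x : ℝ, ∀ e : ℝ, 0 < e → Real.exp x ≤ e → x ≤ Real.log K + e / K - 1 := by
      intro x e he h
      have h1 : x ≤ Real.log e := (Real.le_log_iff_exp_le he).2 h
      have h2 := Real.log_le_sub_one_of_pos (div_pos he hKpos)
      rw [Real.log_div he.ne' hKpos.ne'] at h2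
      linarith
    have hEy : ∀ j, Real.exp (∑ v, (lam * t j v) * y v) ≤ E y ∧
        Real.exp (∑ v, (-lam * t j v) * y v) ≤ E y := by
      intro j
      have := Finset.single_le_sum (f := fun j => (Real.exp (∑ v, (lam * t j v) * y v) +
        Real.exp (∑ v, (-lam * t j v) * y v))) (fun j _ => by positivity) (Finset.mem_univ j)
      have h1 := Real.exp_pos (∑ v, (lam * t j v) * y v)
      have h2 := Real.exp_pos (∑ v, (-lam * t j v) * y v)
      simp only [hE]
      constructor <;> linarith
    have habs : ∀ j, |∑ v, t j v * y v| ≤ Real.sqrt s * (Real.log K + E y / K - 1) := by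
      intro j
      have hEpos : 0 < E y := (Real.exp_pos _).trans_le (hEy j).1
      have a1 := hx _ _ hEpos (hEy j).1
      have a2 := hx _ _ hEpos (hEy j).2
      simp_rw [mul_assoc] at a1 a2
      rw [← Finset.mul_sum] at a1 a2
      have hsq : Real.sqrt s * lam = 1 := by rw [hlam]; field_simp
      have : ∀ z w : ℝ, lam * z ≤ w → z ≤ Real.sqrt s * w := by
        intro z w h
        have := mul_le_mul_of_nonneg_left h (Real.sqrt_nonneg s)
        rwa [← mul_assoc, hsq, one_mul] at this
      refine abs_le'.2 ⟨this _ _ a1, this _ _ ?_⟩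
      linarith
    refine (pi_norm_le_iff_of_nonempty _).2 fun j => ?_
    rw [Real.norm_eq_abs]; exact habs j
  have hbi : Integrable (fun y => Real.sqrt s * (Real.log K + E y / K - 1)) γ := by
    refine Integrable.const_mul ?_ _
    exact ((integrable_const _).add (hEi.div_const _)).sub (integrable_const _)
  have hmi : Integrable (fun y : V → ℝ => ‖fun j => ∑ v, t j v * y v‖) γ := by
    refine hbi.mono' (Continuous.aestronglyMeasurable (by fun_prop)) 
      (Filter.Eventually.of_forall fun y => ?_)
    rw [norm_norm]; exact hpt y
  refine ⟨hmi, (integral_mono hmi hbi hpt).trans ?_⟩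
  rw [integral_const_mul, integral_sub (f := fun y => Real.log K + E y / K)
    ((integrable_const _).add (hEi.div_const _)) (integrable_const _), integral_add (integrable_const _) (hEi.div_const _), integral_div]
  simp only [integral_const, probReal_univ, smul_eq_mul, one_mul]
  gcongr
  have : (∫ y, E y ∂γ) / K ≤ 1 := (div_le_one hKpos).2 hEv
  have hlog : Real.log K = Real.log (2 * Fintype.card J) + B / 2 := by
    rw [hK, Real.log_mul (by positivity) (by positivity), Real.log_exp]
  linarith

/-- running maximum -/
noncomputable def runmax (M : ℕ → ℝ) : ℕ → ℝ
  | 0 => 0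
  | k + 1 => max (runmax M k) (M (k + 1))

lemma runmax_nonneg (M : ℕ → ℝ) (k : ℕ) : 0 ≤ runmax M k := by
  induction k with
  | zero => simp [runmax]
  | succ k ih => exact ih.trans (le_max_left _ _)

lemma le_runmax (M : ℕ → ℝ) (h0 : M 0 = 0) (K k : ℕ) (hk : k ≤ K) : M k ≤ runmax M K := by
  induction K with
  | zero => obtain rfl : k = 0 := by omega
            simp [runmax, h0]
  | succ K ih =>
    rcases Nat.lt_or_ge K k with h | h
    · obtain rfl : k = K + 1 := by omega
      exact le_max_right _ _
    · exact (ih h).trans (le_max_left _ _)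

lemma runmax_congr (M M' : ℕ → ℝ) (K : ℕ) (h : ∀ k ≤ K, M k = M' k) :
    runmax M K = runmax M' K := by
  induction K with
  | zero => rfl
  | succ K ih =>
    simp only [runmax]
    rw [ih (fun k hk => h k (by omega)), h (K + 1) le_rfl]

lemma runmax_path (M : ℕ → ℝ) (k : ℕ) :
    (runmax M k) ^ 2 / 2 ≤ runmax M k * M k
      - ∑ l ∈ Finset.range k, runmax M l * (M (l + 1) - M l) := by
  induction k with
  | zero => simp [runmax]
  | succ k ih =>
    rw [Finset.sum_range_succ]
    simp only [runmax]
    rcases le_total (runmax M k) (M (k + 1)) with h | h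
    · rw [max_eq_right h]
      nlinarith [sq_nonneg (M (k + 1) - runmax M k)]
    · rw [max_eq_left h]
      nlinarith

lemma runmax_sq (M : ℕ → ℝ) (k : ℕ) :
    (runmax M k) ^ 2 ≤ 4 * M k ^ 2
      - 4 * ∑ l ∈ Finset.range k, runmax M l * (M (l + 1) - M l) := by
  nlinarith [runmax_path M k, sq_nonneg (runmax M k - 2 * M k)]

section samp
variable {Ω : Type*} [Finite Ω] [MeasurableSpace Ω] [MeasurableSingletonClass Ω]
  (P : Measure Ω) [IsProbabilityMeasure P]

lemma coord_zero {n : ℕ} (i : Fin n) (g : (Fin n → Ω) → ℝ) (h : Ω → ℝ)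
    (hz : ∀ X : Fin n → Ω, ∫ x, g (Function.update X i x) * h x ∂P = 0) :
    ∫ X, g X * h (X i) ∂(Measure.pi fun _ : Fin n => P) = 0 := by
  obtain ⟨m, rfl⟩ : ∃ m, n = m + 1 := ⟨n - 1, by have := i.2; omega⟩
  have hne : Nonempty Ω := P.nonempty_of_neZero
  obtain ⟨x0⟩ := hne
  have mp := (measurePreserving_piFinSuccAbove (fun _ : Fin (m + 1) => P) i).symm
  rw [← mp.integral_comp', integral_prod_symm _ (Integrable.of_finite)]
  refine integral_eq_zero_of_ae (Filter.Eventually.of_forall fun Y => ?_)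
  have := hz (i.insertNth x0 Y)
  simp only [Fin.update_insertNth] at this
  simp only [MeasurableEquiv.piFinSuccAbove_symm_apply, Pi.zero_apply]
  rw [← this]
  refine integral_congr_ae (Filter.Eventually.of_forall fun x => ?_)
  have e : (Fin.insertNthEquiv (fun _ : Fin (m + 1) => Ω) i) (x, Y) = i.insertNth x Y := rfl
  simp only [e, Fin.insertNth_apply_same]

lemma max_side_aux {n : ℕ} (A : ℕ → Set Ω) (hA : Monotone A) (K : ℕ)
    (hK : P.real (A K) ≤ 1 / 2) (c : ℝ) (hc : c ^ 2 = 1) :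
    ∫ X, (runmax (fun k => ∑ i, c * ((A k).indicator (fun _ => (1 : ℝ)) (X i) - P.real (A k))
      / (1 - P.real (A k))) K) ^ 2 ∂(Measure.pi fun _ : Fin n => P) ≤ 4 * n := by
  set p : ℕ → ℝ := fun k => P.real (A k) with hp
  set h : ℕ → Ω → ℝ := fun k x => c * ((A k).indicator (fun _ => (1 : ℝ)) x - p k) / (1 - p k)
    with hh
  set M : (Fin n → Ω) → ℕ → ℝ := fun X k => ∑ i, h k (X i) with hM
  have hpk : ∀ k ≤ K, p k ≤ 1 / 2 := fun k hk => (measureReal_mono (hA hk)).trans hK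
  have hp0 : ∀ k, 0 ≤ p k := fun k => measureReal_nonneg
  have hind : ∀ k, ∫ x, (A k).indicator (fun _ => (1 : ℝ)) x ∂P = p k := by
    intro k
    rw [integral_indicator (Set.toFinite _).measurableSet]
    simp [hp]
  have hmean : ∀ k, ∫ x, h k x ∂P = 0 := by
    intro k
    simp only [hh]
    rw [integral_div, integral_const_mul, integral_sub Integrable.of_finite Integrable.of_finite,
      hind]
    simp
  have hvar : ∫ x, h K x ^ 2 ∂P ≤ 1 := by
    have e : ∀ x, h K x ^ 2 = ((A K).indicator (fun _ => (1 : ℝ)) x * (1 - 2 * p K) + p K ^ 2)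
        / (1 - p K) ^ 2 := by
      intro x
      simp only [hh]
      rw [div_pow, mul_pow, hc]
      by_cases hx : x ∈ A K <;> simp [hx] <;> ring
    simp_rw [e]
    rw [integral_div, integral_add Integrable.of_finite Integrable.of_finite, integral_mul_const,
      hind]
    have h1 := hpk K le_rfl
    have h2 := hp0 K
    simp only [integral_const, probReal_univ, smul_eq_mul, one_mul]
    rw [div_le_one (by nlinarith)]
    nlinarith
  have hcross : ∀ l < K, ∀ i, 
      ∫ X, runmax (M X) l * (h (l + 1) (X i) - h l (X i)) ∂(Measure.pi fun _ : Fin n => P) = 0 := by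
    intro l hl i
    refine coord_zero P i (fun X => runmax (M X) l) (fun x => h (l + 1) x - h l x) fun X => ?_
    have hx0 : ∃ x0, x0 ∉ A l := by
      by_contra! hcon
      have : A l = Set.univ := Set.eq_univ_of_forall hcon
      have h1 := hpk l hl.le
      simp only [hp, this, probReal_univ] at h1
      norm_num at h1
    obtain ⟨x0, hx0⟩ := hx0
    have e : ∀ x, runmax (M (Function.update X i x)) l * (h (l + 1) x - h l x) =
        runmax (M (Function.update X i x0)) l * (h (l + 1) x - h l x) := by
      intro x
      by_cases hx : x ∈ A l
      · have hx' : x ∈ A (l + 1) := hA (Nat.le_succ l) hx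
        have h1 := hpk l hl.le
        have h2 := hpk (l + 1) hl
        have h1' : 1 - p l ≠ 0 := by linarith
        have h2' : 1 - p (l + 1) ≠ 0 := by linarith
        have : h (l + 1) x - h l x = 0 := by
          simp only [hh, Set.indicator_of_mem hx, Set.indicator_of_mem hx']
          rw [mul_div_assoc, mul_div_assoc, div_self h1', div_self h2', sub_self]
        simp [this]
      · congr 1
        refine runmax_congr _ _ _ fun k hk => ?_
        refine Finset.sum_congr rfl fun j _ => ?_
        by_cases hj : j = i
        · subst hj
          simp only [Function.update_self, hh]
          rw [Set.indicator_of_notMem (fun hm => hx (hA hk hm)),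
            Set.indicator_of_notMem (fun hm => hx0 (hA hk hm))]
        · simp [Function.update_of_ne hj]
    simp_rw [e]
    rw [integral_const_mul, integral_sub Integrable.of_finite Integrable.of_finite, hmean, hmean]
    simp
  have hsq : ∫ X, M X K ^ 2 ∂(Measure.pi fun _ : Fin n => P) ≤ n := by
    have e : ∀ X, M X K ^ 2 = ∑ i, ∑ j, h K (X j) * h K (X i) := by
      intro X
      rw [sq, Finset.sum_mul_sum, Finset.sum_comm]
    simp_rw [e]
    rw [integral_finsetSum _ (fun _ _ => Integrable.of_finite)]
    have : ∀ i ∈ (Finset.univ : Finset (Fin n)), ∫ X, ∑ j, h K (X j) * h K (X i) 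
        ∂(Measure.pi fun _ : Fin n => P) ≤ 1 := by
      intro i _
      rw [integral_finsetSum _ (fun _ _ => Integrable.of_finite), Finset.sum_eq_single i]
      · rw [integral_comp_eval (μ := fun _ : Fin n => P) (i := i) (f := fun x => h K x * h K x)
          (Integrable.of_finite).aestronglyMeasurable]
        simpa [sq] using hvar
      · intro j _ hj
        refine coord_zero P i (fun X => h K (X j)) (h K) fun X => ?_
        simp only [Function.update_of_ne hj]
        rw [integral_const_mul, hmean, mul_zero]
      · simp
    refine (Finset.sum_le_sum this).trans ?_
    simp
  calc ∫ X, (runmax (M X) K) ^ 2 ∂(Measure.pi fun _ : Fin n => P)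
      ≤ ∫ X, (4 * M X K ^ 2 - 4 * ∑ l ∈ Finset.range K, runmax (M X) l * (M X (l + 1) - M X l)) 
        ∂(Measure.pi fun _ : Fin n => P) := 
        integral_mono Integrable.of_finite Integrable.of_finite (fun X => runmax_sq _ _)
    _ = 4 * ∫ X, M X K ^ 2 ∂(Measure.pi fun _ : Fin n => P) := by
        rw [integral_sub Integrable.of_finite Integrable.of_finite, integral_const_mul,
          integral_const_mul, integral_finsetSum _ (fun _ _ => Integrable.of_finite),
          Finset.sum_eq_zero]
        · simp
        · intro l hl
          have e : ∀ X, runmax (M X) l * (M X (l + 1) - M X l) = 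
              ∑ i, runmax (M X) l * (h (l + 1) (X i) - h l (X i)) := by
            intro X
            rw [← Finset.mul_sum, Finset.sum_sub_distrib]
          simp_rw [e]
          rw [integral_finsetSum _ (fun _ _ => Integrable.of_finite)]
          exact Finset.sum_eq_zero fun i _ => hcross l (Finset.mem_range.1 hl) i
    _ ≤ 4 * n := by linarith

lemma max_side {n : ℕ} (hn : 0 < n) (A : ℕ → Set Ω) (hA : Monotone A) (hA0 : A 0 = ∅) (K : ℕ)
    (hK : P.real (A K) ≤ 1 / 2) :
    ∃ W : (Fin n → Ω) → ℝ, (∀ X, 0 ≤ W X) ∧ (∀ X, ∀ k ≤ K, 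
      |∑ i, ((A k).indicator (fun _ => (1 : ℝ)) (X i) - P.real (A k))| ≤ W X) ∧
      ∫ X, W X ∂(Measure.pi fun _ : Fin n => P) ≤ 4 * Real.sqrt n := by
  have hn' : (0 : ℝ) < n := by exact_mod_cast hn
  set M : ℝ → (Fin n → Ω) → ℕ → ℝ := fun c X k => 
    ∑ i, c * ((A k).indicator (fun _ => (1 : ℝ)) (X i) - P.real (A k))
      / (1 - P.real (A k)) with hM
  have hE : ∀ c : ℝ, c ^ 2 = 1 → 
      ∫ X, runmax (M c X) K ∂(Measure.pi fun _ : Fin n => P) ≤ 2 * Real.sqrt n := by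
    intro c hc
    have h1 := max_side_aux (n := n) P A hA K hK c hc
    have hs : 0 < Real.sqrt n := Real.sqrt_pos.2 hn'
    have hss : Real.sqrt n ^ 2 = n := Real.sq_sqrt hn'.le
    calc ∫ X, runmax (M c X) K ∂(Measure.pi fun _ : Fin n => P)
        ≤ ∫ X, ((runmax (M c X) K) ^ 2 * (1 / (4 * Real.sqrt n)) + Real.sqrt n) 
          ∂(Measure.pi fun _ : Fin n => P) := by
          refine integral_mono Integrable.of_finite Integrable.of_finite (fun X => ?_)
          change runmax (M c X) K ≤ (runmax (M c X) K) ^ 2 * (1 / (4 * Real.sqrt n)) + Real.sqrt n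
          have : (runmax (M c X) K) ^ 2 * (1 / (4 * Real.sqrt n)) + Real.sqrt n - runmax (M c X) K
            = (runmax (M c X) K - 2 * Real.sqrt n) ^ 2 * (1 / (4 * Real.sqrt n)) := by
            field_simp; ring
          have h2 : 0 ≤ (runmax (M c X) K - 2 * Real.sqrt n) ^ 2 * (1 / (4 * Real.sqrt n)) := by
            positivity
          linarith
      _ ≤ 4 * n * (1 / (4 * Real.sqrt n)) + Real.sqrt n := by
          rw [integral_add Integrable.of_finite Integrable.of_finite, integral_mul_const]
          simp only [integral_const, probReal_univ, smul_eq_mul, one_mul]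
          gcongr
      _ = 2 * Real.sqrt n := by
          nth_rewrite 1 [← hss]
          field_simp; ring
  have hM0 : ∀ c X, M c X 0 = 0 := by
    intro c X; simp [hM, hA0]
  refine ⟨fun X => runmax (M 1 X) K + runmax (M (-1) X) K, fun X => 
    add_nonneg (runmax_nonneg _ _) (runmax_nonneg _ _), fun X k hk => ?_, ?_⟩
  · have a1 := le_runmax (M 1 X) (hM0 1 X) K k hk
    have a2 := le_runmax (M (-1) X) (hM0 (-1) X) K k hk
    have b1 := runmax_nonneg (M 1 X) K
    have b2 := runmax_nonneg (M (-1) X) K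
    have hpk : P.real (A k) ≤ 1 / 2 := (measureReal_mono (hA hk)).trans hK
    have hp0 : 0 ≤ P.real (A k) := measureReal_nonneg
    set G := ∑ i, ((A k).indicator (fun _ => (1 : ℝ)) (X i) - P.real (A k)) with hG
    have e1 : ∀ c, M c X k = c * G / (1 - P.real (A k)) := by
      intro c
      simp only [hM, hG]
      rw [Finset.mul_sum, Finset.sum_div]
    rw [e1, div_le_iff₀ (by linarith)] at a1 a2
    refine abs_le'.2 ⟨?_, ?_⟩ <;> nlinarith
  · rw [integral_add Integrable.of_finite Integrable.of_finite]
    linarith [hE 1 (by norm_num), hE (-1) (by norm_num)]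

end samp

lemma sampling {D n : ℕ} (hn : 0 < n) (P : Measure (Fin D)) [IsProbabilityMeasure P] :
    ∫ X, ‖fun j : Fin D => (∑ i, if X i ≤ j then (1 : ℝ) else 0) / n - (P {k | k ≤ j}).toReal‖
      ∂(Measure.pi fun _ : Fin n => P) ≤ 8 * Real.sqrt (1 / n) := by
  have hn' : (0 : ℝ) < n := by exact_mod_cast hn
  let A : ℕ → Set (Fin D) := fun k => {x | x.val < k}
  let B : ℕ → Set (Fin D) := fun k => {x | D ≤ x.val + k}
  have side : ∀ A : ℕ → Set (Fin D), Monotone A → A 0 = ∅ → 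
      ∃ W : (Fin n → Fin D) → ℝ, (∀ X, 0 ≤ W X) ∧ (∀ X, ∀ k ≤ D, P.real (A k) ≤ 1 / 2 →
      |∑ i, ((A k).indicator (fun _ => (1 : ℝ)) (X i) - P.real (A k))| ≤ W X) ∧
      ∫ X, W X ∂(Measure.pi fun _ : Fin n => P) ≤ 4 * Real.sqrt n := by
    intro A hA hA0
    classical
    have := max_side P hn A hA hA0 (Nat.findGreatest (fun k => P.real (A k) ≤ 1 / 2) D) 
      (Nat.findGreatest_spec (P := fun k => P.real (A k) ≤ 1 / 2) (Nat.zero_le D) (by simp [hA0]))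
    obtain ⟨W, h0, h1, h2⟩ := this
    exact ⟨W, h0, fun X k hk hpk => h1 X k (Nat.le_findGreatest hk hpk), h2⟩
  obtain ⟨W, hW0, hW1, hW2⟩ := side A (fun a b hab x hx => lt_of_lt_of_le hx hab) (by simp [A])
  obtain ⟨U, hU0, hU1, hU2⟩ := side B (fun a b hab x (hx : D ≤ x.val + a) => 
      (show D ≤ x.val + b by omega)) (by ext x; simp [B])
  have hpt : ∀ X : Fin n → Fin D, 
      ‖fun j : Fin D => (∑ i, if X i ≤ j then (1 : ℝ) else 0) / n - (P {k | k ≤ j}).toReal‖ ≤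
      (W X + U X) / n := by
    intro X
    refine (pi_norm_le_iff_of_nonneg (div_nonneg (add_nonneg (hW0 X) (hU0 X)) hn'.le)).2 fun j => ?_
    rw [Real.norm_eq_abs]
    have hAj : {k : Fin D | k ≤ j} = A (j.val + 1) := by
      ext x; simp only [A, Set.mem_ofPred_eq, Fin.le_def]; omega
    have hBj : (A (j.val + 1))ᶜ = B (D - 1 - j.val) := by
      ext x; simp only [A, B, Set.mem_ofPred_eq, Set.mem_compl_iff]
      have := x.2; have := j.2; omega
    set q := (P {k | k ≤ j}).toReal with hq
    have hqA : P.real (A (j.val + 1)) = q := by rw [hq, hAj]; rfl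
    have hqB : P.real (B (D - 1 - j.val)) = 1 - q := by
      rw [← hBj, probReal_compl_eq_one_sub (Set.toFinite _).measurableSet, hqA]
    have e : (∑ i, if X i ≤ j then (1 : ℝ) else 0) / n - q = 
        (∑ i, ((if X i ≤ j then (1 : ℝ) else 0) - q)) / n := by
      rw [Finset.sum_sub_distrib]; simp; field_simp
    rw [e, abs_div, abs_of_pos hn']
    gcongr
    rcases le_total q (1 / 2) with hq2 | hq2
    · have := hW1 X (j.val + 1) (by have := j.2; omega) (by rw [hqA]; exact hq2)
      rw [hqA, ← hAj] at this
      simp only [Set.indicator_apply, Set.mem_ofPred_eq] at this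
      linarith [hU0 X]
    · have := hU1 X (D - 1 - j.val) (by omega) (by rw [hqB]; linarith)
      rw [hqB, ← hBj, ← hAj, ← abs_neg, ← Finset.sum_neg_distrib] at this
      have e2 : ∀ i, -(({k : Fin D | k ≤ j}ᶜ).indicator (fun _ => (1 : ℝ)) (X i) - (1 - q)) =
          (if X i ≤ j then (1 : ℝ) else 0) - q := by
        intro i
        by_cases hx : X i ≤ j <;> simp [hx]
      simp_rw [e2] at this
      linarith [hW0 X]
  refine (integral_mono Integrable.of_finite Integrable.of_finite hpt).trans ?_
  rw [integral_div, integral_add Integrable.of_finite Integrable.of_finite]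
  have e : Real.sqrt (1 / n) = Real.sqrt n / n := by
    rw [Real.sqrt_div zero_le_one, Real.sqrt_one]
    rw [div_eq_div_iff (by positivity) (by positivity), Real.mul_self_sqrt hn'.le, one_mul]
  rw [e, ← mul_div_assoc]
  gcongr
  linarith

/-- empirical CDF -/
noncomputable def emp {D n : ℕ} (X : Fin n → Fin D) : Fin D → ℝ :=
  fun j => (∑ i, if X i ≤ j then (1 : ℝ) else 0) / n

/-- membership of a point in a dyadic node -/
noncomputable def nodeR {d : ℕ} (v : Fin (d + 1) × Fin (2 ^ d)) (x : Fin (2 ^ d)) : ℝ :=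
  if x.val / 2 ^ v.1.val = v.2.val then 1 else 0

/-- nodes used for a prefix -/
noncomputable def nodeL {d : ℕ} (j : Fin (2 ^ d)) (v : Fin (d + 1) × Fin (2 ^ d)) : ℝ :=
  if ((j.val + 1) / 2 ^ v.1.val) % 2 = 1 ∧ v.2.val + 1 = (j.val + 1) / 2 ^ v.1.val then 1 else 0

lemma step_half (a b : ℕ) : (if a < b then (1 : ℝ) else 0) =
    (if b % 2 = 1 ∧ a + 1 = b then (1 : ℝ) else 0) + (if a / 2 < b / 2 then (1 : ℝ) else 0) := by
  by_cases h1 : a < b <;> by_cases h2 : b % 2 = 1 ∧ a + 1 = b <;> by_cases h3 : a / 2 < b / 2 <;>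
    first
    | (exfalso; omega)
    | simp [h1, h2, h3]

lemma tele (x k m : ℕ) : (if x < k then (1 : ℝ) else 0) =
    ∑ l ∈ Finset.range m, (if (k / 2 ^ l) % 2 = 1 ∧ x / 2 ^ l + 1 = k / 2 ^ l then (1 : ℝ) else 0)
    + (if x / 2 ^ m < k / 2 ^ m then (1 : ℝ) else 0) := by
  induction m with
  | zero => simp
  | succ m ih =>
    rw [ih, Finset.sum_range_succ, step_half (x / 2 ^ m) (k / 2 ^ m), Nat.div_div_eq_div_mul,
      Nat.div_div_eq_div_mul, ← pow_succ]
    ring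

lemma LR {d : ℕ} (j x : Fin (2 ^ d)) : ∑ v, nodeL j v * nodeR v x =
    if x ≤ j then (1 : ℝ) else 0 := by
  rw [Fintype.sum_prod_type]
  have h1 : ∀ l : Fin (d + 1), ∑ q : Fin (2 ^ d), nodeL j (l, q) * nodeR (l, q) x =
      if ((j.val + 1) / 2 ^ l.val) % 2 = 1 ∧ x.val / 2 ^ l.val + 1 = (j.val + 1) / 2 ^ l.val
      then (1 : ℝ) else 0 := by
    intro l
    have hlt : x.val / 2 ^ l.val < 2 ^ d := (Nat.div_le_self _ _).trans_lt x.2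
    rw [Finset.sum_eq_single ⟨x.val / 2 ^ l.val, hlt⟩]
    · simp [nodeL, nodeR]
    · intro q _ hq
      have : ¬ (x.val / 2 ^ l.val = q.val) := fun h => hq (Fin.ext h.symm)
      simp [nodeR, this]
    · simp
  simp_rw [h1]
  have h2 := tele x.val (j.val + 1) (d + 1)
  have h3 : (j.val + 1) / 2 ^ (d + 1) = 0 := by
    have := j.2
    have h4 : 2 ^ (d + 1) = 2 * 2 ^ d := by ring
    exact Nat.div_eq_of_lt (by omega)
  rw [h3] at h2
  rw [Fin.sum_univ_eq_sum_range (fun l => if ((j.val + 1) / 2 ^ l) % 2 = 1 ∧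
    x.val / 2 ^ l + 1 = (j.val + 1) / 2 ^ l then (1 : ℝ) else 0)]
  simp only [Nat.not_lt_zero, if_false, add_zero] at h2
  rw [← h2]
  exact if_congr (Nat.lt_succ_iff.trans Fin.le_def.symm) rfl rfl

lemma sum_ite_le_one {N : ℕ} (p : Fin N → Prop) [DecidablePred p]
    (h : ∀ a b, p a → p b → a = b) : ∑ q, (if p q then (1 : ℝ) else 0) ≤ 1 := by
  rw [Finset.sum_boole]
  have : (Finset.univ.filter p).card ≤ 1 := by
    rw [Finset.card_le_one]
    intro a ha b hb
    exact h a b (by simpa using ha) (by simpa using hb)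
  exact_mod_cast this

lemma sumL {d : ℕ} (j : Fin (2 ^ d)) : ∑ v, nodeL j v ^ 2 ≤ d + 1 := by
  rw [Fintype.sum_prod_type]
  have h1 : ∀ l ∈ (Finset.univ : Finset (Fin (d + 1))), 
      ∑ q : Fin (2 ^ d), nodeL j (l, q) ^ 2 ≤ 1 := by
    intro l _
    simp only [nodeL, ite_pow, one_pow, ne_eq, OfNat.ofNat_ne_zero, not_false_eq_true, zero_pow]
    exact sum_ite_le_one _ (fun a b ha hb => Fin.ext (by omega))
  refine (Finset.sum_le_sum h1).trans ?_
  simp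

lemma sumR {d : ℕ} (x : Fin (2 ^ d)) : ∑ v, nodeR v x ≤ d + 1 := by
  rw [Fintype.sum_prod_type]
  have h1 : ∀ l ∈ (Finset.univ : Finset (Fin (d + 1))), 
      ∑ q : Fin (2 ^ d), nodeR (l, q) x ≤ 1 := by
    intro l _
    simp only [nodeR]
    exact sum_ite_le_one _ (fun a b ha hb => Fin.ext (by omega))
  refine (Finset.sum_le_sum h1).trans ?_
  simp

lemma sens {d n : ℕ} (X X' : Fin n → Fin (2 ^ d)) (h : Adjacent X X') :
    ∑ v, (∑ i, nodeR v (X i) - ∑ i, nodeR v (X' i)) ^ 2 ≤ 2 * (d + 1) := by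
  obtain ⟨i0, hi0⟩ := h
  have e : ∀ v, ∑ i, nodeR v (X i) - ∑ i, nodeR v (X' i) = nodeR v (X i0) - nodeR v (X' i0) := by
    intro v
    rw [← Finset.sum_sub_distrib, Finset.sum_eq_single i0]
    · intro i _ hi; rw [hi0 i hi, sub_self]
    · simp
  have b : ∀ v ∈ Finset.univ, (∑ i, nodeR v (X i) - ∑ i, nodeR v (X' i)) ^ 2 ≤ 
      nodeR v (X i0) + nodeR v (X' i0) := by
    intro v _
    rw [e]
    simp only [nodeR]
    split_ifs <;> norm_num
  refine (Finset.sum_le_sum b).trans ?_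
  rw [Finset.sum_add_distrib]
  linarith [sumR (X i0), sumR (X' i0)]

lemma rate_bound (d n : ℕ) (hd : 1 ≤ d) (hn : 0 < n) (ε l : ℝ) (hε : 0 < ε) (hl : 0 ≤ l) :
    Real.sqrt (8 * (d + 1) * l / ε ^ 2) * (Real.log (2 * 2 ^ d) + (d + 1) / 2) / n ≤
      36 * ((Real.log (2 ^ d)) ^ ((3 : ℝ) / 2) * Real.sqrt l / (ε * n)) := by
  have hd' : (1 : ℝ) ≤ d := by exact_mod_cast hd
  have hn' : (0 : ℝ) < n := by exact_mod_cast hn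
  have hl1 := Real.log_two_gt_d9
  have hl2 := Real.log_two_lt_d9
  have hx : Real.log (2 ^ d) = d * Real.log 2 := by rw [Real.log_pow]
  set x := Real.log ((2 : ℝ) ^ d) with hxd
  have hdx : (d : ℝ) + 1 ≤ 4 * x := by rw [hx]; nlinarith
  have hx0 : 0 < x := by linarith
  have e1 : x ^ ((3 : ℝ) / 2) = x * Real.sqrt x := by
    rw [Real.sqrt_eq_rpow, ← Real.rpow_one_add' hx0.le (by norm_num)]; norm_num
  have e2 : Real.log (2 * 2 ^ d) ≤ d + 1 := by
    rw [← pow_succ', Real.log_pow]; push_cast; nlinarith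
  have e3 : Real.sqrt (8 * (d + 1) * l / ε ^ 2) ≤ 6 * Real.sqrt x * Real.sqrt l / ε := by
    refine Real.sqrt_le_iff.2 ⟨by positivity, ?_⟩
    rw [div_pow, mul_pow, mul_pow, Real.sq_sqrt hx0.le, Real.sq_sqrt hl]
    refine div_le_div_of_nonneg_right ?_ (by positivity)
    nlinarith [mul_le_mul_of_nonneg_right hdx hl, mul_nonneg hx0.le hl]
  have e4 : 0 ≤ Real.log ((2 : ℝ) * 2 ^ d) := by
    rw [← pow_succ']; exact Real.log_nonneg (one_le_pow₀ (by norm_num))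
  calc Real.sqrt (8 * (d + 1) * l / ε ^ 2) * (Real.log (2 * 2 ^ d) + (d + 1) / 2) / n
      ≤ (6 * Real.sqrt x * Real.sqrt l / ε) * (6 * x) / n := by
        gcongr
        linarith
    _ = _ := by rw [e1]; field_simp; ring

lemma noise_small (d n : ℕ) (hd : 1 ≤ d) (hn : 0 < n) (ε δ : ℝ) (hε : 0 < ε) (hε1 : ε ≤ 1)
    (hδ : 0 < δ) (hδ1 : δ ≤ 1 / 2) :
    ∃ ν : Measure (Fin (2 ^ d) → ℝ), IsProbabilityMeasure ν ∧ Integrable (fun z => ‖z‖) ν ∧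
      ∫ z, ‖z‖ ∂ν ≤ 36 * ((Real.log (2 ^ d)) ^ ((3 : ℝ) / 2) * Real.sqrt (Real.log (1 / δ))
        / (ε * n)) ∧
      DPriv (fun X : Fin n → Fin (2 ^ d) => ν.map (fun z => emp X + z)) ε δ := by
  have hn' : (0 : ℝ) < n := by exact_mod_cast hn
  set l := Real.log (1 / δ) with hl
  have hlδ : Real.log δ = -l := by rw [hl, one_div, Real.log_inv, neg_neg]
  have hl2 : 1 / 2 ≤ l := by
    have h1 : Real.log 2 ≤ l := by
      refine Real.log_le_log (by norm_num) ?_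
      rw [le_div_iff₀ hδ]; linarith
    linarith [Real.log_two_gt_d9]
  have hs0 : (0 : ℝ) < 8 * (d + 1) * l / ε ^ 2 := by positivity
  set s : NNReal := ⟨8 * (d + 1) * l / ε ^ 2, hs0.le⟩ with hs
  have hsr : (s : ℝ) = 8 * (d + 1) * l / ε ^ 2 := rfl
  have hsne : s ≠ 0 := by
    intro h
    rw [h] at hsr; simp only [NNReal.coe_zero] at hsr; linarith
  set γ := (Measure.pi fun _ : Fin (d + 1) × Fin (2 ^ d) => gaussianReal 0 s) with hγ
  let T : (Fin (d + 1) × Fin (2 ^ d) → ℝ) → (Fin (2 ^ d) → ℝ) := 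
    fun y j => (∑ v, nodeL j v * y v) / n
  have hT : Measurable T := by fun_prop
  have hTn : ∀ y, ‖T y‖ = ‖fun j => ∑ v, nodeL j v * y v‖ / n := by
    intro y
    have : T y = (1 / (n : ℝ)) • (fun j => ∑ v, nodeL j v * y v) := by
      ext j; simp [T]; ring
    rw [this, norm_smul, Real.norm_eq_abs, abs_of_pos (by positivity)]; ring
  obtain ⟨gi, gv⟩ := gauss_max (J := Fin (2 ^ d)) s hsne (fun j v => nodeL j v) (d + 1) sumL
  have hTi : Integrable (fun y => ‖T y‖) γ := by
    simp_rw [hTn]; exact gi.div_const _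
  refine ⟨γ.map T, Measure.isProbabilityMeasure_map hT.aemeasurable, ?_, ?_, ?_⟩
  · rw [integrable_map_measure (by fun_prop) hT.aemeasurable]
    exact hTi
  · rw [integral_map hT.aemeasurable (by fun_prop)]
    simp_rw [hTn]
    rw [integral_div]
    refine le_trans ?_ (rate_bound d n hd hn ε l hε (by linarith))
    gcongr
    rw [hsr] at gv
    simpa using gv
  · intro X X' hadj S hS
    let c : (Fin n → Fin (2 ^ d)) → (Fin (d + 1) × Fin (2 ^ d) → ℝ) := fun X v => ∑ i, nodeR v (X i)
    have hemp : ∀ X z, emp X + T z = T (c X + z) := by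
      intro X z
      ext j
      simp only [emp, T, c, Pi.add_apply, mul_add, Finset.sum_add_distrib, Finset.mul_sum, add_div]
      congr 2
      rw [Finset.sum_comm]
      exact Finset.sum_congr rfl fun i _ => (LR j (X i)).symm
    have hM : ∀ X, (Measure.map (fun z => emp X + z) (γ.map T)) S = γ {z | T (c X + z) ∈ S} := by
      intro X
      rw [Measure.map_map (by fun_prop) hT, Measure.map_apply (by fun_prop) hS]
      congr 1
      ext z
      simp [hemp]
    rw [hM, hM]
    let u := c X - c X'
    have hS' : MeasurableSet {w | T (c X' + w) ∈ S} := 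
      (hT.comp (measurable_const_add (c X'))) hS
    have h1 : γ {z | T (c X + z) ∈ S} = 
        (Measure.pi fun v => gaussianReal (u v) s) {w | T (c X' + w) ∈ S} := by
      have : (Measure.pi fun v => gaussianReal (u v) s) = 
          γ.map (fun z v => u v + z v) := by
        rw [hγ, Measure.pi_map_pi (f := fun v y => u v + y) (fun v => by fun_prop)]
        congr 1
        ext v : 1
        rw [gaussianReal_map_const_add, zero_add]
      rw [this, Measure.map_apply (by fun_prop) hS']
      congr 1
      ext z
      have : c X' + (fun v => u v + z v) = c X + z := by
        ext v; simp [u]; ring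
      simp [this]
    rw [h1]
    refine (gauss_dp s hsne u ε (2 * l / ε) (by positivity) _ hS').trans ?_
    gcongr
    rw [← Real.le_log_iff_exp_le hδ, hlδ, hsr]
    have hu : ∑ v, u v ^ 2 ≤ 2 * (d + 1) := sens X X' hadj
    have hη : (∑ v, u v ^ 2) / (2 * (8 * (d + 1) * l / ε ^ 2)) ≤ ε ^ 2 / (8 * l) := by
      calc (∑ v, u v ^ 2) / (2 * (8 * (d + 1) * l / ε ^ 2)) 
          ≤ (2 * (d + 1)) / (2 * (8 * (d + 1) * l / ε ^ 2)) := by gcongr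
        _ = _ := by field_simp
    calc -(2 * l / ε) * ε + (1 + 2 * l / ε) * (2 * l / ε) * 
          ((∑ v, u v ^ 2) / (2 * (8 * (d + 1) * l / ε ^ 2)))
        ≤ -(2 * l / ε) * ε + (1 + 2 * l / ε) * (2 * l / ε) * (ε ^ 2 / (8 * l)) := by gcongr
      _ = -(2 * l) + (ε + 2 * l) / 4 := by field_simp; try ring
      _ ≤ -l := by linarith

lemma noise_all (d n : ℕ) (hd : 1 ≤ d) (hn : 0 < n) (ε δ : ℝ) (hε : 0 < ε) (hε1 : ε ≤ 1)
    (hδ : 0 < δ) (hδ1 : δ < 1) :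
    ∃ ν : Measure (Fin (2 ^ d) → ℝ), IsProbabilityMeasure ν ∧ Integrable (fun z => ‖z‖) ν ∧
      ∫ z, ‖z‖ ∂ν ≤ 72 * ((Real.log (2 ^ d)) ^ ((3 : ℝ) / 2) * Real.sqrt (Real.log (1 / δ))
        / (ε * n)) ∧
      DPriv (fun X : Fin n → Fin (2 ^ d) => ν.map (fun z => emp X + z)) ε δ := by
  have hn' : (0 : ℝ) < n := by exact_mod_cast hn
  have hlog0 : 0 ≤ Real.log ((2 : ℝ) ^ d) := Real.log_nonneg (one_le_pow₀ (by norm_num))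
  rcases le_or_gt δ (1 / 2) with h | h
  · obtain ⟨ν, a, b, c, e⟩ := noise_small d n hd hn ε δ hε hε1 hδ h
    refine ⟨ν, a, b, c.trans ?_, e⟩
    gcongr
    norm_num
  · obtain ⟨ν, a, b, c, e⟩ := noise_small d n hd hn ε (1 / 2) hε hε1 (by norm_num) le_rfl
    have hp : 0 ≤ 2 * δ - 1 := by linarith
    have hq : 0 ≤ 2 * (1 - δ) := by linarith
    have hpq : ENNReal.ofReal (2 * δ - 1) + ENNReal.ofReal (2 * (1 - δ)) = 1 := by
      rw [← ENNReal.ofReal_add hp hq]; ring_nf; simp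
    have hi1 : Integrable (fun z : Fin (2 ^ d) → ℝ => ‖z‖) 
        (ENNReal.ofReal (2 * δ - 1) • Measure.dirac 0) := 
      (integrable_dirac (by simp)).smul_measure ENNReal.ofReal_ne_top
    have hi2 : Integrable (fun z : Fin (2 ^ d) → ℝ => ‖z‖) 
        (ENNReal.ofReal (2 * (1 - δ)) • ν) := b.smul_measure ENNReal.ofReal_ne_top
    refine ⟨ENNReal.ofReal (2 * δ - 1) • Measure.dirac 0 + ENNReal.ofReal (2 * (1 - δ)) • ν,
      ⟨?_⟩, hi1.add_measure hi2, ?_, ?_⟩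
    · simpa only [Measure.add_apply, Measure.smul_apply, measure_univ, smul_eq_mul, mul_one] using hpq
    · rw [integral_add_measure hi1 hi2, integral_smul_measure, integral_smul_measure,
        integral_dirac, ENNReal.toReal_ofReal hq]
      simp only [norm_zero, smul_eq_mul, mul_zero, zero_add]
      have hlog : 1 - δ ≤ Real.log (1 / δ) := by
        rw [one_div, Real.log_inv]; linarith [Real.log_le_sub_one_of_pos hδ]
      have hsq : 1 - δ ≤ Real.sqrt (Real.log (1 / δ)) := by
        refine Real.le_sqrt_of_sq_le ?_
        nlinarith
      have hsq2 : Real.sqrt (Real.log (1 / (1 / 2))) ≤ 1 := by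
        refine Real.sqrt_le_one.2 ?_
        norm_num
        linarith [Real.log_two_lt_d9]
      calc 2 * (1 - δ) * ∫ z, ‖z‖ ∂ν 
          ≤ 2 * (1 - δ) * (36 * ((Real.log (2 ^ d)) ^ ((3 : ℝ) / 2) * 1 / (ε * n))) := by
            refine mul_le_mul_of_nonneg_left (c.trans ?_) hq
            gcongr
        _ = 72 * ((Real.log (2 ^ d)) ^ ((3 : ℝ) / 2) * (1 - δ) / (ε * n)) := by ring
        _ ≤ _ := by gcongr
    · intro X X' hadj S hS
      have h1 := e X X' hadj S hS
      have hm : ∀ X : Fin n → Fin (2 ^ d), Measurable (fun z : Fin (2 ^ d) → ℝ => emp X + z) :=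
        fun X => by fun_prop
      simp only [Measure.map_add _ _ (hm _), Measure.map_smul, Measure.add_apply,
        Measure.smul_apply, smul_eq_mul] at h1 ⊢
      have hpr : IsProbabilityMeasure (Measure.map (fun z => emp X + z) (Measure.dirac 0)) :=
        Measure.isProbabilityMeasure_map (hm X).aemeasurable
      set m := (Measure.map (fun z => emp X + z) ν) S
      set m' := (Measure.map (fun z => emp X' + z) ν) S
      set D' := (Measure.map (fun z => emp X' + z) (Measure.dirac 0)) S
      calc _ ≤ ENNReal.ofReal (2 * δ - 1) * 1 + ENNReal.ofReal (2 * (1 - δ)) * 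
            (ENNReal.ofReal (Real.exp ε) * m' + ENNReal.ofReal (1 / 2)) := by
            gcongr
            exact prob_le_one
        _ = ENNReal.ofReal (Real.exp ε) * (ENNReal.ofReal (2 * (1 - δ)) * m') + 
            (ENNReal.ofReal (2 * δ - 1) + ENNReal.ofReal (2 * (1 - δ)) * ENNReal.ofReal (1 / 2)) := by
            ring
        _ = ENNReal.ofReal (Real.exp ε) * (ENNReal.ofReal (2 * (1 - δ)) * m') + 
            ENNReal.ofReal δ := by
            rw [← ENNReal.ofReal_mul hq, ← ENNReal.ofReal_add hp (by linarith)]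
            congr 2; ring
        _ ≤ _ := by
            gcongr
            exact le_add_left le_rfl

lemma iSup_eq_norm {D : ℕ} [Nonempty (Fin D)] (f : Fin D → ℝ) : ⨆ j, |f j| = ‖f‖ := by
  apply le_antisymm
  · exact ciSup_le fun j => by simpa using norm_le_pi_norm f j
  · exact (pi_norm_le_iff_of_nonempty _).2 fun j => 
      le_ciSup (f := fun j => |f j|) (Set.finite_range _).bddAbove j

/-- private CDF estimation.  There is a universal constant `C > 0`
such that for every domain size `D = 2^d` (`d ≥ 1`), sample size `n ≥ 1`, and
privacy parameters `0 < ε ≤ 1`, `0 < δ < 1`, there is an `(ε,δ)`-differentially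
private mechanism `M` on datasets from `{1,…,D}` (encoded as `Fin D`) whose output
estimates the CDF `Φ_P(j) = P{k ≤ j}` of any distribution `P`, with expected
`ℓ∞`-error at most `C (√(1/n) + (log D)^{3/2} √(log(1/δ)) / (ε n))` on i.i.d. data. -/
theorem private_cdf_estimation_upper_bound :
    ∃ C : ℝ, 0 < C ∧ ∀ (d n : ℕ), 1 ≤ d → 0 < n → ∀ ε δ : ℝ,
      0 < ε → ε ≤ 1 → 0 < δ → δ < 1 →
      ∃ M : (Fin n → Fin (2 ^ d)) → Measure (Fin (2 ^ d) → ℝ),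
        (∀ X, IsProbabilityMeasure (M X)) ∧ DPriv M ε δ ∧
        ∀ (P : Measure (Fin (2 ^ d))) [IsProbabilityMeasure P],
          (∫ X, ∫ y, (⨆ j : Fin (2 ^ d), |y j - (P {k | k ≤ j}).toReal|)
              ∂(M X) ∂(Measure.pi fun _ : Fin n => P))
            ≤ C * (Real.sqrt (1 / n)
                + (Real.log (2 ^ d)) ^ ((3 : ℝ) / 2) * Real.sqrt (Real.log (1 / δ))
                  / (ε * n)) := by
  refine ⟨72, by norm_num, ?_⟩
  intro d n hd hn ε δ hε hε1 hδ hδ1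
  obtain ⟨ν, hν, hi, hb, hdp⟩ := noise_all d n hd hn ε δ hε hε1 hδ hδ1
  have hm : ∀ X : Fin n → Fin (2 ^ d), Measurable (fun z : Fin (2 ^ d) → ℝ => emp X + z) :=
    fun X => by fun_prop
  refine ⟨fun X => ν.map (fun z => emp X + z), fun X => 
    Measure.isProbabilityMeasure_map (hm X).aemeasurable, hdp, ?_⟩
  intro P hP
  have hne : Nonempty (Fin (2 ^ d)) := P.nonempty_of_neZero
  set Φ : Fin (2 ^ d) → ℝ := fun j => (P {k | k ≤ j}).toReal with hΦ
  have hsup : ∀ y : Fin (2 ^ d) → ℝ, (⨆ j, |y j - (P {k | k ≤ j}).toReal|) = ‖y - Φ‖ := 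
    fun y => iSup_eq_norm (y - Φ)
  simp_rw [hsup]
  have hin : ∀ X : Fin n → Fin (2 ^ d), 
      ∫ y, ‖y - Φ‖ ∂(ν.map (fun z => emp X + z)) ≤ ‖emp X - Φ‖ + ∫ z, ‖z‖ ∂ν := by
    intro X
    rw [integral_map (hm X).aemeasurable (by fun_prop)]
    have h2 : Integrable (fun z : Fin (2 ^ d) → ℝ => ‖emp X - Φ‖ + ‖z‖) ν := 
      (integrable_const _).add hi
    have h1 : ∀ z : Fin (2 ^ d) → ℝ, ‖emp X + z - Φ‖ ≤ ‖emp X - Φ‖ + ‖z‖ := by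
      intro z
      rw [add_sub_right_comm]; exact norm_add_le _ _
    have h3 : Integrable (fun z : Fin (2 ^ d) → ℝ => ‖emp X + z - Φ‖) ν :=
      h2.mono' (by fun_prop) (Filter.Eventually.of_forall fun z => by rw [norm_norm]; exact h1 z)
    refine (integral_mono h3 h2 h1).trans ?_
    rw [integral_add (integrable_const _) hi]
    simp
  refine (integral_mono Integrable.of_finite Integrable.of_finite hin).trans ?_
  rw [integral_add Integrable.of_finite Integrable.of_finite]
  have hs := sampling hn P
  have hs' : ∫ X, ‖emp X - Φ‖ ∂(Measure.pi fun _ : Fin n => P) ≤ 8 * Real.sqrt (1 / n) := hs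
  simp only [integral_const, probReal_univ, smul_eq_mul, one_mul]
  have := Real.sqrt_nonneg (1 / (n : ℝ))
  linarith
end
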